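/- arXiv:1809.00283 — 5 statements merged into one kernel-verified Lean document; each statement's English description precedes it below -/
import Mathlib

section
/- Every finite group whose order is p^n · q^m, where p and q are primes and n, m are non-negative integers, is perfectly-Hopfian. -/
/-- A group is perfectly-Hopfian if every endomorphism with normal image and
perfect quotient is an automorphism. -/
def PerfectlyHopfian (G : Type*) [Group G] : Prop :=
  ∀ φ : G →* G, ∀ hn : φ.range.Normal,
    (haveI := hn; commutator (G ⧸ φ.range) = ⊤) → Function.Bijective φ

theorem norm_multiset_sum_le_card (s : Multiset ℂ) (hs : ∀ z ∈ s, ‖z‖ = 1) :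
    ‖s.sum‖ ≤ s.card := by
  refine (norm_multiset_sum_le s).trans ?_
  rw [Multiset.map_congr rfl hs]
  simp

/-- The equality case of the triangle inequality for unit complex numbers. -/
theorem eq_of_norm_multiset_sum_eq_card {s : Multiset ℂ} (hs : ∀ z ∈ s, ‖z‖ = 1)
    (h : ‖s.sum‖ = s.card) {a b : ℂ} (ha : a ∈ s) (hb : b ∈ s) : a = b := by
  by_contra hab
  obtain ⟨t, rfl⟩ := Multiset.exists_cons_of_mem ha
  have hbt : b ∈ t := (Multiset.mem_cons.1 hb).resolve_left (Ne.symm hab)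
  obtain ⟨t, rfl⟩ := Multiset.exists_cons_of_mem hbt
  have hna : ‖a‖ = 1 := hs a ha
  have hnb : ‖b‖ = 1 := hs b hb
  refine hab (eq_of_norm_eq_of_norm_add_eq (hna.trans hnb.symm) ?_)
  have ht := norm_multiset_sum_le_card t fun z hz =>
    hs z (Multiset.mem_cons_of_mem (Multiset.mem_cons_of_mem hz))
  simp only [Multiset.sum_cons, Multiset.card_cons, ← add_assoc] at h
  push_cast at h
  have h₁ := norm_add_le (a + b) t.sum
  have h₂ := norm_add_le a b
  linarith

/-- A nonzero algebraic integer that is an average of roots of unity has absolute value one. -/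
theorem norm_multiset_sum_eq_card_of_isIntegral {s : Multiset ℂ} {N : ℕ} (hN : 0 < N)
    (hs : ∀ z ∈ s, z ^ N = 1) (hint : IsIntegral ℤ (s.sum / s.card)) (h0 : s.sum ≠ 0) :
    ‖s.sum‖ = s.card := by
  have hc : s.card ≠ 0 := by
    rintro hc
    rw [Multiset.card_eq_zero] at hc
    simp [hc] at h0
  have hc' : (s.card : ℂ) ≠ 0 := by exact_mod_cast hc
  let S : Set ℂ := {z | z ^ N = 1}
  have hSf : S.Finite := by
    refine (Polynomial.nthRoots N (1 : ℂ)).toFinset.finite_toSet.subset fun z hz => ?_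
    simpa [S, Polynomial.mem_nthRoots hN] using hz
  have : Finite S := hSf
  let K := IntermediateField.adjoin ℚ S
  have : FiniteDimensional ℚ K := IntermediateField.finiteDimensional_adjoin fun x hx => by
    refine IsIntegral.of_pow hN ?_
    rw [show x ^ N = 1 from hx]
    exact isIntegral_one
  have : NumberField K := { to_charZero := K.charZero, to_finiteDimensional := this }
  have hK : ∀ z ∈ s, z ∈ K := fun z hz => IntermediateField.subset_adjoin ℚ S (hs z hz)
  let t : Multiset K := s.attach.map fun z => ⟨z.1, hK z.1 z.2⟩
  have hts : t.map (algebraMap K ℂ) = s := by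
    simp only [t, Multiset.map_map]
    exact Multiset.attach_map_val s
  have htc : t.card = s.card := by simp [t]
  have ht : ∀ z ∈ t, z ^ N = 1 := by
    intro z hz
    apply (algebraMap K ℂ).injective
    rw [map_pow, map_one]
    apply hs
    rw [← hts]
    exact Multiset.mem_map_of_mem _ hz
  let x : K := t.sum / t.card
  have hx : algebraMap K ℂ x = s.sum / s.card := by
    rw [map_div₀, map_multiset_sum, hts, map_natCast, htc]
  have hxi : IsIntegral ℤ x := by
    rw [← hx] at hint
    exact (isIntegral_algebraMap_iff (algebraMap K ℂ).injective).1 hint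
  have hx0 : x ≠ 0 := by
    intro h
    rw [h, map_zero] at hx
    exact div_ne_zero h0 hc' hx.symm
  obtain ⟨k, hk, hxk⟩ := NumberField.Embeddings.pow_eq_one_of_norm_le_one K ℂ hx0 hxi fun φ => by
    rw [map_div₀, map_multiset_sum, map_natCast, norm_div, Complex.norm_natCast]
    apply div_le_one_of_le₀ _ (Nat.cast_nonneg _)
    rw [← Multiset.card_map φ t]
    apply norm_multiset_sum_le_card
    intro z hz
    obtain ⟨y, hy, rfl⟩ := Multiset.mem_map.1 hz
    apply Complex.norm_eq_one_of_pow_eq_one _ hN.ne'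
    rw [← map_pow, ht y hy, map_one]
  have h1 : ‖s.sum / s.card‖ = 1 := by
    apply Complex.norm_eq_one_of_pow_eq_one _ hk.ne'
    rw [← hx, ← map_pow, hxk, map_one]
  rw [norm_div, Complex.norm_natCast, div_eq_one_iff_eq (by exact_mod_cast hc)] at h1
  exact h1

section FiniteOrderMatrix

variable {ι : Type*} [Fintype ι] [DecidableEq ι] {M : Matrix ι ι ℂ} {N : ℕ}

theorem pow_eq_one_of_mem_roots_charpoly (hM : M ^ N = 1) {z : ℂ} (hz : z ∈ M.charpoly.roots) :
    z ^ N = 1 := by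
  have h := Matrix.mem_spectrum_of_isRoot_charpoly (Polynomial.isRoot_of_mem_roots hz)
  have : Nontrivial (Matrix ι ι ℂ) := by
    by_contra hn
    rw [not_nontrivial_iff_subsingleton] at hn
    simp [spectrum.of_subsingleton] at h
  have h' := spectrum.pow_mem_pow M N h
  rw [hM, spectrum.one_eq] at h'
  exact h'

theorem card_roots_charpoly : M.charpoly.roots.card = Fintype.card ι := by
  rw [← (IsAlgClosed.splits M.charpoly).natDegree_eq_card_roots, Matrix.charpoly_natDegree_eq_dim]

theorem isIntegral_trace_of_pow_eq_one (hN : 0 < N) (hM : M ^ N = 1) :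
    IsIntegral ℤ M.trace := by
  rw [Matrix.trace_eq_sum_roots_charpoly]
  refine IsIntegral.multiset_sum fun z hz => IsIntegral.of_pow hN ?_
  rw [pow_eq_one_of_mem_roots_charpoly hM hz]
  exact isIntegral_one

/-- A matrix of finite order whose normalized trace is a nonzero algebraic integer is scalar. -/
theorem mem_range_scalar_of_isIntegral_trace_div (hN : 0 < N) (hM : M ^ N = 1)
    (hint : IsIntegral ℤ (M.trace / Fintype.card ι)) (h0 : M.trace ≠ 0) :
    M ∈ Set.range (Matrix.scalar ι) := by
  have hroots : ∀ z ∈ M.charpoly.roots, z ^ N = 1 := fun z => pow_eq_one_of_mem_roots_charpoly hM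
  rw [Matrix.trace_eq_sum_roots_charpoly] at h0
  rw [Matrix.trace_eq_sum_roots_charpoly, ← card_roots_charpoly (M := M)] at hint
  have hnorm := norm_multiset_sum_eq_card_of_isIntegral hN hroots hint h0
  have hall : ∀ a ∈ M.charpoly.roots, ∀ b ∈ M.charpoly.roots, a = b := fun a ha b hb =>
    eq_of_norm_multiset_sum_eq_card
      (fun z hz => Complex.norm_eq_one_of_pow_eq_one (hroots z hz) hN.ne') hnorm ha hb
  obtain ⟨c, hc⟩ : ∃ c, c ∈ M.charpoly.roots := by
    apply Multiset.exists_mem_of_ne_zero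
    rintro h
    simp [h] at h0
  have hrep : M.charpoly = (Polynomial.X - Polynomial.C c) ^ M.charpoly.roots.card := by
    conv_lhs => rw [(IsAlgClosed.splits M.charpoly).eq_prod_roots_of_monic M.charpoly_monic,
      Multiset.eq_replicate_card.2 fun b hb => hall b hb c hc]
    simp
  have hdvd : minpoly ℂ M ∣ Polynomial.X - Polynomial.C c := by
    have hsq : Squarefree (minpoly ℂ M) := by
      have hsep : (Polynomial.X ^ N - 1 : Polynomial ℂ).Separable :=
        Polynomial.X_pow_sub_one_separable_iff.2 (by exact_mod_cast hN.ne')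
      refine hsep.squarefree.squarefree_of_dvd (minpoly.dvd _ _ ?_)
      simp [hM]
    refine (hsq.dvd_pow_iff_dvd (n := M.charpoly.roots.card) ?_).1 ?_
    · exact (Multiset.card_pos_iff_exists_mem.2 ⟨c, hc⟩).ne'
    · rw [← hrep]
      exact M.minpoly_dvd_charpoly
  have h := minpoly.dvd_iff.1 hdvd
  refine ⟨c, ?_⟩
  simp [sub_eq_zero] at h
  rw [h]
  simp [Matrix.algebraMap_eq_diagonal]

end FiniteOrderMatrix

section Trace

theorem trace_mulLeft_pi_matrix {κ : Type*} [Fintype κ] {ι : κ → Type*} [∀ i, Fintype (ι i)]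
    [∀ i, DecidableEq (ι i)] (x : ∀ i, Matrix (ι i) (ι i) ℂ) :
    LinearMap.trace ℂ (∀ i, Matrix (ι i) (ι i) ℂ) (LinearMap.mulLeft ℂ x) =
      ∑ i, (Fintype.card (ι i) : ℂ) * (x i).trace := by
  classical
  rw [LinearMap.trace_eq_matrix_trace ℂ (Pi.basis fun i => Matrix.stdBasis ℂ (ι i) (ι i)),
    Matrix.trace, Fintype.sum_sigma]
  refine Finset.sum_congr rfl fun i _ => ?_
  rw [Fintype.sum_prod_type_right]
  have key : ∀ a b, LinearMap.toMatrix (Pi.basis fun i => Matrix.stdBasis ℂ (ι i) (ι i))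
      (Pi.basis fun i => Matrix.stdBasis ℂ (ι i) (ι i)) (LinearMap.mulLeft ℂ x)
      ⟨i, (a, b)⟩ ⟨i, (a, b)⟩ = x i a a := by
    intro a b
    rw [LinearMap.toMatrix_apply, Pi.basis_repr, Pi.basis_apply, LinearMap.mulLeft_apply,
      Pi.mul_apply, Pi.single_eq_same, Matrix.stdBasis_eq_single]
    simp [Matrix.stdBasis]
  simp [Matrix.diag, key, Matrix.trace]

theorem trace_mulLeft_of_ne_one {G : Type*} [Group G] [Finite G] {g : G} (hg : g ≠ 1) :
    LinearMap.trace ℂ (MonoidAlgebra ℂ G) (LinearMap.mulLeft ℂ (MonoidAlgebra.of ℂ G g)) = 0 := by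
  classical
  have := Fintype.ofFinite G
  rw [LinearMap.trace_eq_matrix_trace ℂ (MonoidAlgebra.basis G ℂ), Matrix.trace]
  refine Finset.sum_eq_zero fun h _ => ?_
  rw [Matrix.diag_apply, LinearMap.toMatrix_apply]
  have : MonoidAlgebra.of ℂ G g * MonoidAlgebra.basis G ℂ h = MonoidAlgebra.basis G ℂ (g * h) := by
    simp [MonoidAlgebra.single_mul_single]
  rw [LinearMap.mulLeft_apply, this, Module.Basis.repr_self, Finsupp.single_apply, if_neg]
  simpa using hg

end Trace

section Character

variable {G : Type*} [Group G] {ι : Type*} [Fintype ι] [DecidableEq ι]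
  {f : MonoidAlgebra ℂ G →ₐ[ℂ] Matrix ι ι ℂ}

theorem commute_of_commute_of (f : MonoidAlgebra ℂ G →ₐ[ℂ] Matrix ι ι ℂ) {z : Matrix ι ι ℂ}
    (h : ∀ g, Commute (f (.of ℂ G g)) z) (a : MonoidAlgebra ℂ G) : Commute (f a) z := by
  induction a using MonoidAlgebra.induction_on with
  | of g => exact h g
  | add a b ha hb => rw [map_add]; exact ha.add_left hb
  | smul r a ha => rw [map_smul]; exact ha.smul_left r

theorem mem_range_scalar_of_commute_of (hf : Function.Surjective f) {z : Matrix ι ι ℂ}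
    (h : ∀ g, Commute (f (.of ℂ G g)) z) : z ∈ Set.range (Matrix.scalar ι) := by
  refine Matrix.mem_range_scalar_iff_commute_single'.2 fun i j => ?_
  obtain ⟨a, ha⟩ := hf (Matrix.single i j 1)
  rw [← ha]
  exact commute_of_commute_of f h a

/-- The eigenvalue of a class sum in an irreducible representation is an algebraic integer. -/
theorem isIntegral_card_conjugatesOf_mul_trace_div [Finite G] [Nonempty ι]
    (hf : Function.Surjective f) (g : G) :
    IsIntegral ℤ
      (Nat.card (conjugatesOf g) * (f (.of ℂ G g)).trace / Fintype.card ι : ℂ) := by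
  classical
  have := Fintype.ofFinite G
  let C : Finset G := (conjugatesOf g).toFinset
  have hC : ∀ x, x ∈ C ↔ IsConj g x := fun x => Set.mem_toFinset
  let ρ : G →* Matrix ι ι ℂ := (f : MonoidAlgebra ℂ G →* Matrix ι ι ℂ).comp (MonoidAlgebra.of ℂ G)
  let z : Matrix ι ι ℂ := ∑ x ∈ C, ρ x
  have hzi : IsIntegral ℤ z := by
    have : z = MonoidAlgebra.lift ℤ (Matrix ι ι ℂ) G ρ (∑ x ∈ C, .of ℤ G x) := by
      simp [z]
    rw [this]
    exact (IsIntegral.of_finite ℤ _).map (MonoidAlgebra.lift ℤ (Matrix ι ι ℂ) G ρ)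
  have hcomm : ∀ h, Commute (ρ h) z := by
    intro h
    change ρ h * z = z * ρ h
    simp only [z, Finset.mul_sum, Finset.sum_mul]
    refine Finset.sum_bij' (fun x _ => h * x * h⁻¹) (fun x _ => h⁻¹ * x * h) ?_ ?_ ?_ ?_ ?_
    · intro x hx
      rw [hC] at hx ⊢
      exact hx.trans (isConj_iff.2 ⟨h, rfl⟩)
    · intro x hx
      rw [hC] at hx ⊢
      exact hx.trans (isConj_iff.2 ⟨h⁻¹, by simp⟩)
    · intro x _; group
    · intro x _; group
    · intro x _; rw [← map_mul, ← map_mul]; congr 1; group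
  obtain ⟨ω, hω⟩ := mem_range_scalar_of_commute_of hf hcomm
  have htr : z.trace = Nat.card (conjugatesOf g) * (ρ g).trace := by
    rw [Matrix.trace_sum, Nat.card_eq_card_toFinset, ← nsmul_eq_mul]
    refine Finset.sum_eq_card_nsmul fun x hx => ?_
    rw [hC, isConj_iff] at hx
    obtain ⟨c, rfl⟩ := hx
    rw [map_mul, Matrix.trace_mul_comm, ← map_mul]
    congr 2
    group
  have hωi : IsIntegral ℤ ω := by
    rw [← hω] at hzi
    exact (isIntegral_algebraMap_iff (A := ℂ) (B := Matrix ι ι ℂ)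
      (algebraMap ℂ (Matrix ι ι ℂ)).injective).1 hzi
  have hval : (Nat.card (conjugatesOf g) * (ρ g).trace / Fintype.card ι : ℂ) = ω := by
    rw [← htr, ← hω, div_eq_iff (by simp)]
    simp [Matrix.trace, mul_comm]
  change IsIntegral ℤ (Nat.card (conjugatesOf g) * (ρ g).trace / Fintype.card ι : ℂ)
  rwa [hval]

theorem of_pow_card (f : MonoidAlgebra ℂ G →ₐ[ℂ] Matrix ι ι ℂ) (g : G) :
    f (.of ℂ G g) ^ Nat.card G = 1 := by
  rw [← map_pow, ← map_pow, pow_card_eq_one', map_one, map_one]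

/-- If the degree of an irreducible character is prime to the size of the conjugacy class of `g`,
then the character vanishes at `g` or `g` acts as a scalar. -/
theorem trace_eq_zero_or_mem_range_scalar_of_coprime [Finite G] [Nonempty ι]
    (hf : Function.Surjective f) (g : G)
    (hcop : (Nat.card (conjugatesOf g)).Coprime (Fintype.card ι)) :
    (f (.of ℂ G g)).trace = 0 ∨ f (.of ℂ G g) ∈ Set.range (Matrix.scalar ι) := by
  refine or_iff_not_imp_left.2 fun h0 =>
    mem_range_scalar_of_isIntegral_trace_div Nat.card_pos (of_pow_card f g) ?_ h0
  have h₁ := isIntegral_card_conjugatesOf_mul_trace_div hf g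
  have h₂ := isIntegral_trace_of_pow_eq_one Nat.card_pos (of_pow_card f g)
  obtain ⟨a, b, hab⟩ := Nat.isCoprime_iff_coprime.2 hcop
  have hd : (Fintype.card ι : ℂ) ≠ 0 := by simp
  have hab' : (a * Nat.card (conjugatesOf g) + b * Fintype.card ι : ℂ) = 1 := by
    exact_mod_cast hab
  have : (f (.of ℂ G g)).trace / (Fintype.card ι : ℂ) =
      a * (Nat.card (conjugatesOf g) * (f (.of ℂ G g)).trace / Fintype.card ι : ℂ) +
        b * (f (.of ℂ G g)).trace := by
    field_simp
    linear_combination -hab'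
  rw [this]
  exact ((isIntegral_algebraMap (x := a)).mul h₁).add ((isIntegral_algebraMap (x := b)).mul h₂)

end Character

section TrivialComponent

variable {G : Type*} [Group G] {ι κ : Type*} [Fintype ι] [DecidableEq ι] [Fintype κ]
  [DecidableEq κ]

theorem eq_algebraMap_lift_of_forall_eq_one {f : MonoidAlgebra ℂ G →ₐ[ℂ] Matrix ι ι ℂ}
    (h : ∀ g, f (.of ℂ G g) = 1) (a : MonoidAlgebra ℂ G) :
    f a = algebraMap ℂ (Matrix ι ι ℂ) (MonoidAlgebra.lift ℂ ℂ G 1 a) := by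
  have : f = (Algebra.ofId ℂ (Matrix ι ι ℂ)).comp (MonoidAlgebra.lift ℂ ℂ G 1) := by
    refine MonoidAlgebra.algHom_ext (fun g => ?_) (Subsingleton.elim _ _)
    simpa using h g
  rw [this]
  rfl

theorem card_eq_one_of_forall_eq_one [Nonempty ι] {f : MonoidAlgebra ℂ G →ₐ[ℂ] Matrix ι ι ℂ}
    (hf : Function.Surjective f) (h : ∀ g, f (.of ℂ G g) = 1) : Fintype.card ι = 1 := by
  refine le_antisymm (Fintype.card_le_one_iff.2 fun i j => ?_) Fintype.card_pos
  by_contra hij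
  obtain ⟨a, ha⟩ := hf (Matrix.single i j 1)
  rw [eq_algebraMap_lift_of_forall_eq_one h] at ha
  have := congrFun (congrFun ha i) j
  simp [Matrix.algebraMap_matrix_apply, hij] at this

/-- In a perfect group whose only normal subgroups are trivial, a nontrivial element acts as a
scalar only in trivial representations. -/
theorem eq_one_of_mem_range_scalar
    (hsimple : ∀ N : Subgroup G, N.Normal → N = ⊥ ∨ N = ⊤) (hperf : commutator G = ⊤)
    {g : G} (hg : g ≠ 1) (ρ : G →* Matrix ι ι ℂ) (h : ρ g ∈ Set.range (Matrix.scalar ι)) (x : G) :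
    ρ x = 1 := by
  rcases hsimple ρ.ker inferInstance with hker | hker
  · have hinj : Function.Injective ρ := (MonoidHom.ker_eq_bot_iff ρ).1 hker
    obtain ⟨c, hc⟩ := h
    have hgc : g ∈ Subgroup.center G := Subgroup.mem_center_iff.2 fun y => hinj <| by
      rw [map_mul, map_mul, ← hc]
      exact ((Matrix.scalar_commute c (fun _ => Commute.all _ _) (ρ y)).eq).symm
    rcases hsimple (Subgroup.center G) inferInstance with hcen | hcen
    · rw [hcen, Subgroup.mem_bot] at hgc
      exact absurd hgc hg
    · have : commutator G = ⊥ := by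
        rw [commutator_def, Subgroup.commutator_eq_bot_iff_le_centralizer,
          Subgroup.coe_top, Subgroup.centralizer_univ, hcen]
      have hx : g ∈ commutator G := hperf ▸ Subgroup.mem_top g
      rw [this, Subgroup.mem_bot] at hx
      exact absurd hx hg
  · have : x ∈ ρ.ker := hker ▸ Subgroup.mem_top x
    exact this

end TrivialComponent

theorem not_isIntegral_neg_one_div {r : ℕ} (hr : r.Prime) : ¬IsIntegral ℤ (-1 / r : ℂ) := by
  intro h
  have h' : IsIntegral ℤ (-1 / r : ℚ) := by
    refine (isIntegral_algebraMap_iff (B := ℂ) (algebraMap ℚ ℂ).injective).1 ?_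
    simpa using h
  obtain ⟨a, ha⟩ := IsIntegrallyClosed.isIntegral_iff.1 h'
  have hr0 : (r : ℚ) ≠ 0 := by exact_mod_cast hr.ne_zero
  have ha' : (a : ℚ) = -1 / r := ha
  rw [eq_div_iff hr0] at ha'
  have ha'' : a * r = -1 := by exact_mod_cast ha'
  have : (r : ℤ) ∣ 1 := ⟨-a, by linarith⟩
  exact hr.one_lt.ne' (by exact_mod_cast Int.eq_one_of_dvd_one (by positivity) this)

/-- **Burnside's lemma** on conjugacy classes of prime power size, for perfect groups. -/
theorem card_conjugatesOf_ne_prime_pow {G : Type*} [Group G] [Finite G]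
    (hsimple : ∀ N : Subgroup G, N.Normal → N = ⊥ ∨ N = ⊤) (hperf : commutator G = ⊤)
    {g : G} (hg : g ≠ 1) {r : ℕ} (hr : r.Prime) (k : ℕ) :
    Nat.card (conjugatesOf g) ≠ r ^ k := by
  classical
  intro hcard
  have := Fintype.ofFinite G
  obtain ⟨n, d, hd, ⟨e⟩⟩ :=
    IsSemisimpleRing.exists_algEquiv_pi_matrix_of_isAlgClosed ℂ (MonoidAlgebra ℂ G)
  let f (i : Fin n) : MonoidAlgebra ℂ G →ₐ[ℂ] Matrix (Fin (d i)) (Fin (d i)) ℂ :=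
    (Pi.evalAlgHom ℂ (fun i => Matrix (Fin (d i)) (Fin (d i)) ℂ) i).comp (e : _ →ₐ[ℂ] _)
  have hf (i) : Function.Surjective (f i) := (Function.surjective_eval i).comp e.surjective
  -- the trivial representation occurs
  obtain ⟨i₀, hi₀⟩ : ∃ i, ∀ h, f i (.of ℂ G h) = 1 := by
    let E : MonoidAlgebra ℂ G := ∑ h, .of ℂ G h
    have hE : e E ≠ 0 := by
      rw [Ne, EmbeddingLike.map_eq_zero_iff]
      intro h0
      have := congrArg (MonoidAlgebra.lift ℂ ℂ G 1) h0
      simp [E] at this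
    have hleft (h : G) : .of ℂ G h * E = E := by
      simp only [E, Finset.mul_sum, ← map_mul]
      exact Fintype.sum_equiv (Equiv.mulLeft h) _ _ fun _ => rfl
    have hright (h : G) : E * .of ℂ G h = E := by
      simp only [E, Finset.sum_mul, ← map_mul]
      exact Fintype.sum_equiv (Equiv.mulRight h) _ _ fun _ => rfl
    obtain ⟨i, hi⟩ := Function.ne_iff.1 hE
    change f i E ≠ 0 at hi
    obtain ⟨c, hc⟩ := mem_range_scalar_of_commute_of (hf i) (z := f i E) fun h => by
      rw [Commute, SemiconjBy, ← map_mul, ← map_mul, hleft, hright]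
    have hc0 : c ≠ 0 := by
      rintro rfl
      exact hi (by rw [← hc, map_zero])
    refine ⟨i, fun h => ?_⟩
    have hu : IsUnit (f i E) := by
      rw [← hc]
      exact (IsUnit.mk0 c hc0).map (Matrix.scalar (Fin (d i)))
    apply hu.mul_right_cancel
    rw [← map_mul, hleft, one_mul]
  have huniq : ∀ i, (∀ h, f i (.of ℂ G h) = 1) → i = i₀ := by
    intro i hi
    by_contra hne
    let a := e.symm (Pi.single i 1)
    have h₁ : f i a = 1 := by simp [f, a]
    have h₂ : f i₀ a = 0 := by simp [f, a, Ne.symm hne]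
    rw [eq_algebraMap_lift_of_forall_eq_one hi] at h₁
    rw [eq_algebraMap_lift_of_forall_eq_one hi₀] at h₂
    have h₃ := (algebraMap ℂ (Matrix (Fin (d i)) (Fin (d i)) ℂ)).injective
      (h₁.trans (map_one _).symm)
    have h₄ := (algebraMap ℂ (Matrix (Fin (d i₀)) (Fin (d i₀)) ℂ)).injective
      (h₂.trans (map_zero _).symm)
    exact one_ne_zero (h₃.symm.trans h₄)
  have hsum : ∑ i, (d i : ℂ) * (f i (MonoidAlgebra.of ℂ G g)).trace = 0 := by
    have h := trace_mulLeft_pi_matrix (e (MonoidAlgebra.of ℂ G g))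
    have hconj : LinearMap.mulLeft ℂ (e (MonoidAlgebra.of ℂ G g)) =
        e.toLinearEquiv.conj (LinearMap.mulLeft ℂ (MonoidAlgebra.of ℂ G g)) := by
      refine LinearMap.ext fun x => ?_
      simp [LinearEquiv.conj_apply]
    rw [hconj, LinearMap.trace_conj', trace_mulLeft_of_ne_one hg] at h
    simpa [f] using h.symm
  have hint : IsIntegral ℤ
      (∑ i ∈ Finset.univ.erase i₀, (d i : ℂ) * (f i (.of ℂ G g)).trace / r) := by
    refine IsIntegral.sum _ fun i hi => ?_
    have hns : f i (.of ℂ G g) ∉ Set.range (Matrix.scalar (Fin (d i))) := fun hs =>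
      Finset.ne_of_mem_erase hi <| huniq i <| eq_one_of_mem_range_scalar hsimple hperf hg
        ((f i : MonoidAlgebra ℂ G →* Matrix (Fin (d i)) (Fin (d i)) ℂ).comp
          (MonoidAlgebra.of ℂ G)) hs
    by_cases hrd : r ∣ d i
    · obtain ⟨b, hb⟩ := hrd
      have hr0 : (r : ℂ) ≠ 0 := by exact_mod_cast hr.ne_zero
      have : (d i : ℂ) * (f i (.of ℂ G g)).trace / r = b * (f i (.of ℂ G g)).trace := by
        have hb' : (d i : ℂ) = r * b := by exact_mod_cast hb
        rw [hb']
        field_simp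
      rw [this]
      exact (isIntegral_algebraMap (x := (b : ℤ))).mul
        (isIntegral_trace_of_pow_eq_one Nat.card_pos (of_pow_card (f i) g))
    · have h0 := (trace_eq_zero_or_mem_range_scalar_of_coprime (hf i) g (by
        rw [hcard, Fintype.card_fin]
        exact ((Nat.Prime.coprime_iff_not_dvd hr).2 hrd).pow_left k)).resolve_right hns
      rw [h0, mul_zero, zero_div]
      exact isIntegral_zero
  have hd₀ : d i₀ = 1 := by simpa using card_eq_one_of_forall_eq_one (hf i₀) hi₀
  rw [← Finset.add_sum_erase _ _ (Finset.mem_univ i₀), hi₀, Matrix.trace_one, Fintype.card_fin,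
    hd₀, Nat.cast_one, one_mul] at hsum
  rw [← Finset.sum_div, eq_neg_of_add_eq_zero_right hsum] at hint
  exact not_isIntegral_neg_one_div hr hint

section GroupTheory

variable {G : Type*} [Group G] [Finite G]

theorem card_conjugatesOf_dvd_index {g : G} {H : Subgroup G} (hH : H ≤ Subgroup.centralizer {g}) :
    Nat.card (conjugatesOf g) ∣ H.index := by
  have h₁ : Nat.card (conjugatesOf g) = (MulAction.stabilizer (ConjAct G) g).index := by
    rw [MulAction.index_stabilizer, ConjAct.orbit_eq_carrier_conjClasses]
    rfl
  have h₂ : (MulAction.stabilizer (ConjAct G) g).index = (Subgroup.centralizer {g}).index := by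
    apply Nat.eq_of_mul_eq_mul_left (Nat.card_pos (α := Subgroup.centralizer {g}))
    rw [Subgroup.card_mul_index, Subgroup.nat_card_centralizer_nat_card_stabilizer,
      Subgroup.card_mul_index]
    rfl
  rw [h₁, h₂]
  exact Subgroup.index_dvd_of_le hH

theorem exists_card_conjugatesOf_eq_prime_pow {p q n m : ℕ} (hp : p.Prime) (hq : q.Prime)
    (hcard : Nat.card G = p ^ n * q ^ m) (hdvd : p ∣ Nat.card G) :
    ∃ g : G, g ≠ 1 ∧ ∃ k, Nat.card (conjugatesOf g) = q ^ k := by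
  have := Fact.mk hp
  let P : Sylow p G := default
  have hpP : p ∣ Nat.card P := P.dvd_card_of_dvd_card hdvd
  have : Nontrivial P := Finite.one_lt_card_iff_nontrivial.1
    (hp.one_lt.trans_le (Nat.le_of_dvd Nat.card_pos hpP))
  have := P.isPGroup'.center_nontrivial
  obtain ⟨⟨z, hz⟩, hz1⟩ := exists_ne (1 : Subgroup.center P)
  refine ⟨z, fun h => hz1 (Subtype.ext (Subtype.ext h)), ?_⟩
  have hle : (P : Subgroup G) ≤ Subgroup.centralizer {(z : G)} := fun x hx =>
    Subgroup.mem_centralizer_singleton_iff.2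
      (congrArg Subtype.val (Subgroup.mem_center_iff.1 hz ⟨x, hx⟩))
  have hcop : (P : Subgroup G).index.Coprime (p ^ n) :=
    (P.card_coprime_index.coprime_dvd_left hpP).symm.pow_right n
  have hq' : (P : Subgroup G).index ∣ q ^ m :=
    hcop.dvd_of_dvd_mul_left (hcard ▸ Subgroup.index_dvd_card _)
  obtain ⟨k, -, hk⟩ := (Nat.dvd_prime_pow hq).1 ((card_conjugatesOf_dvd_index hle).trans hq')
  exact ⟨k, hk⟩

end GroupTheory

theorem commutator_quotient_eq_top {G : Type*} [Group G]
    (hperf : commutator G = ⊤) (N : Subgroup G) [N.Normal] : commutator (G ⧸ N) = ⊤ := by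
  have hs := QuotientGroup.mk'_surjective N
  rw [commutator_def, ← Subgroup.map_top_of_surjective _ hs, ← Subgroup.map_commutator,
    ← commutator_def, hperf]

/-- **Burnside's theorem**: a perfect group of order `p ^ n * q ^ m` is trivial. -/
theorem subsingleton_of_commutator_eq_top {p q : ℕ} (hp : p.Prime) (hq : q.Prime) {G : Type*}
    [Group G] [Finite G] {n m : ℕ} (hcard : Nat.card G = p ^ n * q ^ m)
    (hperf : commutator G = ⊤) : Subsingleton G := by
  induction hN : Nat.card G using Nat.strong_induction_on generalizing G n m with
  | _ N ih =>
  subst hN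
  by_contra hns
  rw [not_subsingleton_iff_nontrivial] at hns
  have hsimple : ∀ N : Subgroup G, N.Normal → N = ⊥ ∨ N = ⊤ := by
    intro N hN
    refine or_iff_not_imp_left.2 fun hbot => ?_
    have hmul := N.card_eq_card_quotient_mul_card_subgroup
    have hlt : Nat.card (G ⧸ N) < Nat.card G := by
      rw [hmul]
      exact lt_mul_of_one_lt_right Nat.card_pos (Subgroup.one_lt_card_iff_ne_bot N |>.2 hbot)
    obtain ⟨a, b, ha, hb, hab⟩ := exists_dvd_and_dvd_of_dvd_mul (hcard ▸ Dvd.intro _ hmul.symm)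
    obtain ⟨n', -, rfl⟩ := (Nat.dvd_prime_pow hp).1 ha
    obtain ⟨m', -, rfl⟩ := (Nat.dvd_prime_pow hq).1 hb
    have := ih _ hlt hab (commutator_quotient_eq_top hperf N) rfl
    exact QuotientGroup.subgroup_eq_top_of_subsingleton N this
  have hprime := Nat.minFac_prime (Finite.one_lt_card (α := G)).ne'
  have hdvd := Nat.minFac_dvd (Nat.card G)
  have hpq : p ∣ Nat.card G ∨ q ∣ Nat.card G := by
    have h := hdvd
    nth_rw 2 [hcard] at h
    rcases hprime.dvd_mul.1 h with h | h
    · exact .inl ((Nat.prime_dvd_prime_iff_eq hprime hp).1 (hprime.dvd_of_dvd_pow h) ▸ hdvd)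
    · exact .inr ((Nat.prime_dvd_prime_iff_eq hprime hq).1 (hprime.dvd_of_dvd_pow h) ▸ hdvd)
  rcases hpq with h | h
  · obtain ⟨g, hg, k, hk⟩ := exists_card_conjugatesOf_eq_prime_pow hp hq hcard h
    exact card_conjugatesOf_ne_prime_pow hsimple hperf hg hq k hk
  · rw [mul_comm] at hcard
    obtain ⟨g, hg, k, hk⟩ := exists_card_conjugatesOf_eq_prime_pow hq hp hcard h
    exact card_conjugatesOf_ne_prime_pow hsimple hperf hg hp k hk

theorem pq_group_isPerfectlyHopfian (G : Type*) [Group G] [Finite G]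
    (p q n m : ℕ) (hp : p.Prime) (hq : q.Prime)
    (hcard : Nat.card G = p ^ n * q ^ m) : PerfectlyHopfian G := by
  intro φ hn hperf
  obtain ⟨a, b, ha, hb, hab⟩ := exists_dvd_and_dvd_of_dvd_mul
    (hcard ▸ Dvd.intro _ φ.range.card_eq_card_quotient_mul_card_subgroup.symm)
  obtain ⟨n', -, rfl⟩ := (Nat.dvd_prime_pow hp).1 ha
  obtain ⟨m', -, rfl⟩ := (Nat.dvd_prime_pow hq).1 hb
  have := subsingleton_of_commutator_eq_top hp hq hab hperf
  exact Finite.surjective_iff_bijective.1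
    (MonoidHom.range_eq_top.1 (QuotientGroup.subgroup_eq_top_of_subsingleton _ this))
end

section
/- For every natural number n with 1 ≤ n, the free group on n generators is perfectly-Hopfian. -/
/-- An endomorphism of `G` with normal image and perfect quotient by it is surjective on the
abelianization. -/
theorem Abelianization.map_surjective_of_perfect_quotient {G : Type*} [Group G] (φ : G →* G)
    [φ.range.Normal] (h : commutator (G ⧸ φ.range) = ⊤) :
    Function.Surjective (Abelianization.map φ) := by
  let R := (Abelianization.map φ).range
  let f : G →* Abelianization G ⧸ R := (QuotientGroup.mk' R).comp Abelianization.of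
  have hf : φ.range ≤ f.ker := by
    rintro _ ⟨x, rfl⟩
    rw [MonoidHom.mem_ker]
    exact (QuotientGroup.eq_one_iff _).2 ⟨Abelianization.of x, Abelianization.map_of φ x⟩
  let g : G ⧸ φ.range →* Abelianization G ⧸ R := QuotientGroup.lift φ.range f hf
  intro a
  obtain ⟨x, rfl⟩ := QuotientGroup.mk_surjective (s := commutator G) a
  have hx : (x : G ⧸ φ.range) ∈ g.ker :=
    Abelianization.commutator_subset_ker g (h ▸ Subgroup.mem_top _)
  exact (QuotientGroup.eq_one_iff (N := R) (Abelianization.of x)).1 hx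

/-- Homomorphisms to commutative groups identify elements with equal classes in the
abelianization. -/
theorem MonoidHom.eq_of_abelianization_of_eq {G A : Type*} [Group G] [CommGroup A] (f : G →* A)
    {x y : G} (hxy : Abelianization.of x = Abelianization.of y) : f x = f y := by
  rw [← Abelianization.lift_apply_of f, hxy, Abelianization.lift_apply_of]

/-- Surjective endomorphisms of finitely generated commutative groups are injective. -/
theorem CommGroup.injective_of_surjective_of_fg {A : Type*} [CommGroup A] [Group.FG A]
    (f : A →* A) (hf : Function.Surjective f) : Function.Injective f := by
  have : Module.Finite ℤ (Additive A) := Module.Finite.iff_addGroup_fg.2 inferInstance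
  exact OrzechProperty.injective_of_surjective_endomorphism
    (MonoidHom.toAdditive f).toIntLinearMap hf

namespace FreeGroup

universe u

variable {α : Type u}

/-- Every nontrivial element of a free group survives in a finite permutation group. -/
theorem exists_hom_perm_ne_one {x : FreeGroup α} (hx : x ≠ 1) :
    ∃ (X : Type u) (_ : Finite X) (ρ : FreeGroup α →* Equiv.Perm X), ρ x ≠ 1 := by
  classical
  let S : Set (FreeGroup α) := {y | y ∈ x.toWord.tails.map mk}
  have hfin : Finite S := List.finite_toSet (x.toWord.tails.map mk)
  have hS (L : List (α × Bool)) (hL : L <:+ x.toWord) : mk L ∈ S :=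
    List.mem_map_of_mem ((List.mem_tails _ _).2 hL)
  have hext (a : α) : ∃ σ : Equiv.Perm S, ∀ v (hv : v ∈ S) (hav : of a * v ∈ S),
      σ ⟨v, hv⟩ = ⟨of a * v, hav⟩ := by
    obtain ⟨σ, hσ⟩ := Equiv.Perm.exists_extending_pair
      (α := {v : S // of a * v.1 ∈ S}) (β := S) (fun v => v.1) (fun v => ⟨of a * v.1.1, v.2⟩)
      Subtype.val_injective (fun u v huv => by
        simpa [Subtype.ext_iff] using huv)
    exact ⟨σ, fun v hv hav => hσ ⟨⟨v, hv⟩, hav⟩⟩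
  choose σ hσ using hext
  refine ⟨S, hfin, lift σ, fun h => hx ?_⟩
  have key (L : List (α × Bool)) (hL : L <:+ x.toWord) :
      lift σ (mk L) ⟨1, hS [] (List.nil_suffix)⟩ = ⟨mk L, hS L hL⟩ := by
    induction L with
    | nil => simp [← one_eq_mk]
    | cons c L ih =>
      have hL' : L <:+ x.toWord := (List.suffix_cons c L).trans hL
      have hmem := hS _ hL
      obtain ⟨a, b⟩ := c
      have hcons : mk ((a, b) :: L) = mk [(a, b)] * mk L := by simp [mul_mk]
      cases b with
      | true =>
        have hcons' : mk ((a, true) :: L) = of a * mk L := hcons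
        have h1 := hσ a (mk L) (hS L hL') (hcons' ▸ hmem)
        simp only [hcons', _root_.map_mul, Equiv.Perm.mul_apply, ih hL', lift_apply_of, h1]
      | false =>
        have hcons' : mk ((a, false) :: L) = (of a)⁻¹ * mk L := hcons
        have h1 := hσ a ((of a)⁻¹ * mk L) (hcons' ▸ hmem) (by simpa using hS L hL')
        simp only [hcons', _root_.map_mul, Equiv.Perm.mul_apply, ih hL', lift_apply_of,
          _root_.map_inv]
        rw [Equiv.Perm.inv_eq_iff_eq, h1]
        simp
  have := key x.toWord (List.suffix_refl _)
  have hval := congrArg Subtype.val this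
  simp only [mk_toWord, h] at hval
  exact hval.symm

/-- Finitely generated free groups are Hopfian. -/
theorem injective_of_surjective [Finite α] (φ : FreeGroup α →* FreeGroup α)
    (hφ : Function.Surjective φ) : Function.Injective φ := by
  rw [injective_iff_map_eq_one]
  intro x hx
  by_contra hne
  obtain ⟨X, _, ρ, hρ⟩ := exists_hom_perm_ne_one hne
  have : Finite (FreeGroup α →* Equiv.Perm X) := Finite.of_equiv _ lift
  have hinj : Function.Injective fun τ : FreeGroup α →* Equiv.Perm X => τ.comp φ :=
    fun _ _ h => (MonoidHom.cancel_right hφ).1 h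
  obtain ⟨τ, hτ⟩ := Finite.surjective_of_injective hinj ρ
  apply hρ
  rw [← hτ]
  simp [hx]

/-- Crossed homomorphisms on a free group may be prescribed arbitrarily on the generators. -/
theorem exists_crossedHom {R : Type*} [Ring R] (ρ : FreeGroup α →* R) (d : α → R) :
    ∃ D : FreeGroup α → R, (∀ x y, D (x * y) = D x + ρ x * D y) ∧ ∀ a, D (of a) = d a := by
  let u : FreeGroup α →* Rˣ := ρ.toHomUnits
  let T : FreeGroup α →* Equiv.Perm R :=
    lift fun a => (Units.mulLeft (u (of a))).trans (Equiv.addRight (d a))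
  have hof (a : α) (v : R) : T (of a) v = ρ (of a) * v + d a := by simp [T, u]
  have hT (x : FreeGroup α) : ∀ v, T x v = T x 0 + ρ x * v := by
    induction x using FreeGroup.induction_on with
    | C1 => simp
    | of a => intro v; simp [hof, add_comm]
    | inv_of a _ =>
      intro v
      rw [_root_.map_inv, Equiv.Perm.inv_eq_iff_eq, hof, mul_add, ← mul_assoc, ← _root_.map_mul,
        mul_inv_cancel, _root_.map_one, one_mul]
      have h0 := hof a ((T (of a))⁻¹ 0)
      rw [← Equiv.Perm.mul_apply, mul_inv_cancel, Equiv.Perm.one_apply] at h0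
      rw [add_right_comm, ← h0, zero_add]
    | mul x y hx hy =>
      intro v
      simp only [_root_.map_mul, Equiv.Perm.mul_apply]
      rw [hx (T y v), hy v, hx (T y 0), mul_add, mul_assoc, add_assoc]
  exact ⟨fun x => T x 0, fun x y => by simpa using hT x (T y 0), fun a => by simp [hof]⟩

/-- An endomorphism of a nontrivial free group with normal image that is bijective on the
abelianization is surjective. -/
theorem surjective_of_abelianization_map_bijective [Nonempty α] (φ : FreeGroup α →* FreeGroup α)
    [φ.range.Normal] (h : Function.Bijective (Abelianization.map φ)) :
    Function.Surjective φ := by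
  let Q := FreeGroup α ⧸ φ.range
  let ρ : FreeGroup α →* MonoidAlgebra ℤ Q :=
    (MonoidAlgebra.of ℤ Q).comp (QuotientGroup.mk' φ.range)
  let ε : MonoidAlgebra ℤ Q →ₐ[ℤ] ℤ := MonoidAlgebra.lift ℤ ℤ Q 1
  have hερ (x) : ε (ρ x) = 1 := by simp [ε, ρ]
  have hρφ (x) : ρ (φ x) = 1 := by
    have : ((φ x : FreeGroup α) : Q) = 1 := (QuotientGroup.eq_one_iff _).2 ⟨x, rfl⟩
    exact (congrArg (MonoidAlgebra.of ℤ Q) this).trans (_root_.map_one _)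
  obtain ⟨D, hD, hDof⟩ := exists_crossedHom ρ (fun _ => 1)
  let E : FreeGroup α →* Multiplicative ℤ :=
    MonoidHom.mk' (fun x => .ofAdd (ε (D x))) fun x y => by simp [hD, hερ]
  let K : FreeGroup α →* Multiplicative (MonoidAlgebra ℤ Q) :=
    MonoidHom.mk' (fun x => .ofAdd (D (φ x))) fun x y => by simp [hD, hρφ]
  have hD1 : D 1 = 0 := by simpa using hD 1 1
  obtain ⟨s⟩ := ‹Nonempty α›
  obtain ⟨a, ha⟩ := h.2 (Abelianization.of (of s))
  obtain ⟨x, rfl⟩ : ∃ x, Abelianization.of x = a := QuotientGroup.mk_surjective a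
  rw [Abelianization.map_of] at ha
  have hεD : ε (D (φ x)) = 1 := by
    have : ε (D (φ x)) = ε (D (of s)) := E.eq_of_abelianization_of_eq ha
    simpa [hDof] using this
  have hfix (f : FreeGroup α) : ρ f * D (φ x) = D (φ x) := by
    obtain ⟨y, hy⟩ : f * φ x * f⁻¹ ∈ φ.range :=
      Subgroup.Normal.conj_mem ‹_› _ (MonoidHom.mem_range.2 ⟨x, rfl⟩) f
    have hyx : Abelianization.of y = Abelianization.of x := h.1 (by
      simp [Abelianization.map_of, hy])
    have h1 : D (φ y) = D (φ x) := K.eq_of_abelianization_of_eq hyx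
    have h2 : D f + ρ f * D f⁻¹ = 0 := by rw [← hD, mul_inv_cancel, hD1]
    rw [hy, mul_assoc, hD, hD, hρφ, one_mul, mul_add, add_left_comm, h2, add_zero] at h1
    exact h1
  have hconst (q : Q) : (D (φ x)).coeff q = (D (φ x)).coeff 1 := by
    obtain ⟨f, rfl⟩ := QuotientGroup.mk_surjective q
    conv_lhs => rw [← hfix f]
    have := MonoidAlgebra.coeff_single_mul_apply (D (φ x)) 1 (f : Q) (f : Q)
    rw [inv_mul_cancel, one_mul] at this
    exact this
  have hsum : (D (φ x)).coeff.sum (fun _ b => b) = 1 := by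
    rw [← hεD]
    simp [ε, MonoidAlgebra.lift_apply]
  have hc : (D (φ x)).coeff 1 ≠ 0 := fun h0 => by
    have : (D (φ x)).coeff = 0 := Finsupp.ext fun q => (hconst q).trans h0
    simp [this] at hsum
  have hsupp (q : Q) : q ∈ (D (φ x)).coeff.support := by
    rw [Finsupp.mem_support_iff, hconst]; exact hc
  have hcard : (D (φ x)).coeff.support.card = 1 := by
    rw [Finsupp.sum, Finset.sum_congr rfl fun q _ => hconst q, Finset.sum_const, nsmul_eq_mul]
      at hsum
    exact_mod_cast Int.eq_one_of_mul_eq_one_right (by positivity) hsum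
  intro f
  have : (f : Q) = 1 := Finset.card_le_one.1 hcard.le _ (hsupp _) _ (hsupp _)
  exact (QuotientGroup.eq_one_iff f).1 this

end FreeGroup

theorem freeGroup_isPerfectlyHopfian (n : ℕ) (hn : 1 ≤ n) :
    PerfectlyHopfian (FreeGroup (Fin n)) := by
  intro φ hφ h
  have : Nonempty (Fin n) := ⟨⟨0, hn⟩⟩
  have hfg : Group.FG (Abelianization (FreeGroup (Fin n))) := QuotientGroup.fg _
  have hsurj := Abelianization.map_surjective_of_perfect_quotient φ h
  have hs := FreeGroup.surjective_of_abelianization_map_bijective φ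
    ⟨CommGroup.injective_of_surjective_of_fg _ hsurj, hsurj⟩
  exact ⟨FreeGroup.injective_of_surjective φ hs, hs⟩
end

section
/- Let F be a free group on a generating set of cardinality at least 2, and let H be a finitely generated group that can be generated by strictly fewer elements than the cardinality of the generating set of F. Then H is normally incommensurable with F. -/
/-- `G` is normally incommensurable with `H` if there is no nontrivial homomorphism
`f : G →* H` with `f(G)` a normal subgroup of some normal subgroup `K` of `H`. -/
def NormallyIncommensurable (G H : Type*) [Group G] [Group H] : Prop :=
  ¬ ∃ (f : G →* H) (K : Subgroup H), f ≠ 1 ∧ K.Normal ∧ f.range ≤ K ∧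
      (f.range.subgroupOf K).Normal

namespace FreeGroup

variable {α : Type*}

lemma IsCyclicallyReduced.invRev {u : List (α × Bool)} (hu : IsCyclicallyReduced u) :
    IsCyclicallyReduced (invRev u) := by
  classical
  refine ⟨?_, ?_⟩
  · rw [isReduced_iff_reduce_eq, reduce_invRev, hu.isReduced.reduce_eq]
  · have h := hu.2
    intro a ha b hb hab
    simp only [FreeGroup.invRev, List.getLast?_reverse, List.head?_reverse, List.head?_map,
      List.getLast?_map, Option.mem_def, Option.map_eq_some_iff] at ha hb
    obtain ⟨a', ha', rfl⟩ := ha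
    obtain ⟨b', hb', rfl⟩ := hb
    simpa using (h b' hb' a' ha' hab.symm).symm

lemma IsReduced.append_or_append_invRev {L u : List (α × Bool)} (hL : IsReduced L)
    (hu : IsCyclicallyReduced u) : IsReduced (L ++ u) ∨ IsReduced (L ++ invRev u) := by
  have hv := hu.invRev.isReduced
  rcases List.eq_nil_or_concat L with rfl | ⟨L', z, rfl⟩
  · exact Or.inl (by simpa using hu.isReduced)
  by_contra! h
  obtain ⟨h₁, h₂⟩ := h
  rw [IsReduced, List.isChain_append] at h₁ h₂
  simp only [not_and, not_forall] at h₁ h₂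
  obtain ⟨x, hx, y, hy, hxy, hne⟩ := h₁ hL hu.isReduced
  obtain ⟨x', hx', y', hy', hxy', hne'⟩ := h₂ hL hv
  simp only [FreeGroup.invRev, List.head?_reverse,
      List.getLast?_map, Option.mem_def, Option.map_eq_some_iff] at hy'
  obtain ⟨b, hb, rfl⟩ := hy'
  have := hu.2 b hb y hy
  grind

lemma prefix_reduce_append [DecidableEq α] {p A : List (α × Bool)} (B : List (α × Bool))
    (hA : IsReduced A) (hp : p <+: A) (hlen : p.length + B.length ≤ A.length) :
    p <+: reduce (A ++ B) := by
  induction B generalizing A with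
  | nil => simpa [hA.reduce_eq] using hp
  | cons b B ih =>
    by_cases h : IsReduced (A ++ [b])
    · have := ih h (hp.trans (List.prefix_append _ _)) (by simp at hlen ⊢; omega)
      simpa using this
    · rcases List.eq_nil_or_concat A with rfl | ⟨A', z, rfl⟩
      · simp at hlen
      rw [List.concat_eq_append] at *
      have hz : z = (b.1, !b.2) := by
        rw [IsReduced, List.isChain_append] at h
        simp only [not_and, not_forall] at h
        obtain ⟨x, hx, y, hy, hxy, hne⟩ := h hA (by simp)
        simp only [List.getLast?_append, List.getLast?_singleton, List.head?_cons,
          Option.mem_def, Option.some_or, Option.some.injEq] at hx hy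
        subst hx hy
        exact Prod.ext hxy (Bool.eq_not_of_ne hne)
      have hred : reduce (A' ++ [z] ++ b :: B) = reduce (A' ++ B) := by
        apply reduce.Step.eq
        subst hz
        simpa using Red.Step.not_rev (L₁ := A') (L₂ := B) (x := b.1) (b := b.2)
      rw [hred]
      simp at hlen
      refine ih (hA.infix ⟨[], [z], by simp⟩) ?_ (by omega)
      exact List.prefix_of_prefix_length_le hp (List.prefix_append _ _) (by omega)

lemma exists_prefix_toWord_conj [DecidableEq α] {u : List (α × Bool)}
    (hu : IsCyclicallyReduced u) (hne : u ≠ []) (g : FreeGroup α)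
    (hg : IsReduced (g.toWord ++ u)) :
    ∃ k : ℕ, g.toWord <+: (g * mk u ^ k * g⁻¹).toWord := by
  set k := g.toWord.length + 1 with hk
  refine ⟨k, ?_⟩
  have hA : IsReduced (g.toWord ++ (List.replicate k u).flatten) := by
    simpa using IsReduced.append_flatten_replicate_append (L₃ := []) hu (by simpa using hg)
      (n := k) (by omega)
  have h1 : (g * mk u ^ k).toWord = g.toWord ++ (List.replicate k u).flatten := by
    rw [← hA.reduce_eq, ← toWord_mk, ← mul_mk, mk_toWord, pow_mk]
  rw [toWord_mul, h1]
  refine prefix_reduce_append _ hA (List.prefix_append _ _) ?_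
  have : 0 < u.length := List.length_pos_iff.mpr hne
  simp only [toWord_inv, invRev_length, List.length_append, List.length_flatten,
    List.map_replicate, List.sum_replicate, smul_eq_mul]
  nlinarith

lemma exists_mem_prefix_toWord [DecidableEq α] {N : Subgroup (FreeGroup α)} (hN : N.Normal)
    (hne : N ≠ ⊥) (g : FreeGroup α) : ∃ m ∈ N, g.toWord <+: m.toWord := by
  obtain ⟨w, hw, hw1⟩ := N.bot_or_exists_ne_one.resolve_left hne
  set u := reduceCyclically w.toWord with hu
  set c := reduceCyclically.conjugator w.toWord with hc
  have hcyc : IsCyclicallyReduced u := reduceCyclically.isCyclicallyReduced isReduced_toWord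
  have hconj : mk c * mk u * (mk c)⁻¹ = w := by
    rw [inv_mk, mul_mk, mul_mk, reduceCyclically.conj_conjugator_reduceCyclically, mk_toWord]
  have hune : u ≠ [] := by
    intro h
    rw [h, ← one_eq_mk] at hconj
    exact hw1 (by rw [← hconj]; group)
  have hmem : mk u ∈ N := by
    have := hN.conj_mem _ hw (mk c)⁻¹
    rw [← hconj] at this
    convert this using 1
    group
  rcases isReduced_toWord (x := g) |>.append_or_append_invRev hcyc with h | h
  · obtain ⟨k, hk⟩ := exists_prefix_toWord_conj hcyc hune g h
    exact ⟨_, hN.conj_mem _ (N.pow_mem hmem k) g, hk⟩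
  · obtain ⟨k, hk⟩ := exists_prefix_toWord_conj hcyc.invRev
      (by simpa [FreeGroup.invRev] using hune) g h
    refine ⟨_, hN.conj_mem _ (N.pow_mem ?_ k) g, hk⟩
    rw [← inv_mk]
    exact N.inv_mem hmem

/-- All prefixes of `L` represent elements of `T`. -/
def PrefixesIn (T : Set (FreeGroup α)) (L : List (α × Bool)) : Prop :=
  ∀ p q, p ++ q = L → mk p ∈ T

lemma PrefixesIn.red {T : Set (FreeGroup α)} {L L' : List (α × Bool)} (h : PrefixesIn T L)
    (hr : Red L L') : PrefixesIn T L' := by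
  induction hr with
  | refl => exact h
  | tail _ hs ih =>
    rcases hs with @⟨L₁, L₂, x, b⟩
    intro p q hp
    rcases List.append_eq_append_iff.1 hp with ⟨r, rfl, rfl⟩ | ⟨r, rfl, rfl⟩
    · exact ih p (r ++ (x, b) :: (x, !b) :: L₂) (by simp)
    · have := ih (L₁ ++ (x, b) :: (x, !b) :: r) q (by simp)
      rwa [show mk (L₁ ++ (x, b) :: (x, !b) :: r) = mk (L₁ ++ r) from
        Quot.sound Red.Step.not] at this

lemma exists_finite_prefixesIn {N : Subgroup (FreeGroup α)} (hN : N.Normal) (hfg : N.FG) :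
    ∃ T : Set (FreeGroup α ⧸ N), T.Finite ∧
      ∀ m ∈ N, ∃ L, mk L = m ∧ PrefixesIn (QuotientGroup.mk ⁻¹' T) L := by
  classical
  obtain ⟨S, hS⟩ := hfg
  refine ⟨insert 1 (⋃ s ∈ S, ⋃ p ∈ s.toWord.inits.toFinset, {QuotientGroup.mk (mk p)}), ?_, ?_⟩
  · exact (S.finite_toSet.biUnion fun s _ ↦ (Finset.finite_toSet _).biUnion
      fun p _ ↦ Set.finite_singleton _).insert _
  set T : Set (FreeGroup α ⧸ N) :=
    insert 1 (⋃ s ∈ S, ⋃ p ∈ s.toWord.inits.toFinset, {QuotientGroup.mk (mk p)}) with hT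
  intro m hm
  rw [← hS] at hm
  induction hm using Subgroup.closure_induction with
  | mem s hs =>
    refine ⟨s.toWord, mk_toWord, fun p q hpq ↦ Set.mem_insert_of_mem _ ?_⟩
    simp only [Set.mem_iUnion, Set.mem_singleton_iff]
    exact ⟨s, hs, p, by simp [← hpq], rfl⟩
  | one =>
    refine ⟨[], one_eq_mk.symm, fun p q hpq ↦ ?_⟩
    obtain ⟨rfl, -⟩ := List.append_eq_nil_iff.1 hpq
    exact Set.mem_insert _ _
  | mul x y hx hy ihx ihy =>
    obtain ⟨L, rfl, hL⟩ := ihx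
    obtain ⟨M, rfl, hM⟩ := ihy
    refine ⟨L ++ M, mul_mk.symm, fun p q hpq ↦ ?_⟩
    rcases List.append_eq_append_iff.1 hpq with ⟨r, rfl, rfl⟩ | ⟨r, rfl, rfl⟩
    · exact hL p r rfl
    · have h1 : (QuotientGroup.mk (mk L) : FreeGroup α ⧸ N) = 1 :=
        (QuotientGroup.eq_one_iff _).2 (hS ▸ hx)
      rw [Set.mem_preimage, ← mul_mk, QuotientGroup.mk_mul, h1, one_mul]
      exact hM r q rfl
  | inv x hx ihx =>
    obtain ⟨L, rfl, hL⟩ := ihx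
    refine ⟨invRev L, inv_mk.symm, fun p q hpq ↦ ?_⟩
    have hL' : invRev q ++ invRev p = L := by
      rw [← invRev_append, hpq, invRev_invRev]
    have h1 : (QuotientGroup.mk (mk L) : FreeGroup α ⧸ N) = 1 :=
      (QuotientGroup.eq_one_iff _).2 (hS ▸ hx)
    have h2 : (QuotientGroup.mk (mk p) : FreeGroup α ⧸ N) = QuotientGroup.mk (mk (invRev q)) := by
      rw [← hL', ← mul_mk, QuotientGroup.mk_mul, ← inv_mk (L := p), QuotientGroup.mk_inv,
        mul_inv_eq_one] at h1
      exact h1.symm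
    rw [Set.mem_preimage, h2]
    exact hL _ _ hL'

/-- A nontrivial finitely generated normal subgroup of a free group has finite index. -/
theorem finiteIndex_of_normal_of_fg {N : Subgroup (FreeGroup α)} (hN : N.Normal) (hne : N ≠ ⊥)
    (hfg : N.FG) : N.FiniteIndex := by
  classical
  obtain ⟨T, hT, h⟩ := exists_finite_prefixesIn hN hfg
  have : Finite (FreeGroup α ⧸ N) := by
    refine Set.finite_univ_iff.1 (hT.subset fun x _ ↦ ?_)
    obtain ⟨g, rfl⟩ := QuotientGroup.mk_surjective x
    obtain ⟨m, hm, q, hq⟩ := exists_mem_prefix_toWord hN hne g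
    obtain ⟨L, rfl, hL⟩ := h m hm
    have := hL.red reduce.red g.toWord q (by rw [hq, toWord_mk])
    rwa [mk_toWord] at this
  exact Subgroup.finiteIndex_of_finite_quotient

end FreeGroup

theorem IsFreeGroup.finiteIndex_of_normal_of_fg {G : Type*} [Group G] [IsFreeGroup G]
    {N : Subgroup G} (hN : N.Normal) (hne : N ≠ ⊥) (hfg : N.FG) : N.FiniteIndex := by
  let e := IsFreeGroup.mulEquiv G
  have hfi : (N.comap e.toMonoidHom).FiniteIndex := by
    refine FreeGroup.finiteIndex_of_normal_of_fg (hN.comap _) ?_ ?_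
    · intro h
      apply hne
      rw [← Subgroup.map_comap_eq_self_of_surjective (f := e.toMonoidHom) e.surjective N, h,
        Subgroup.map_bot]
    · rw [Subgroup.comap_equiv_eq_map_symm']
      rw [← Group.fg_iff_subgroup_fg] at hfg ⊢
      exact Group.fg_of_surjective (f := (e.symm.subgroupMap N).toMonoidHom)
        (e.symm.subgroupMap N).surjective
  refine ⟨?_⟩
  rw [← Subgroup.index_comap_of_surjective N (f := e.toMonoidHom) e.surjective]
  exact hfi.index_ne_zero

theorem Group.fg_of_finiteIndex {G : Type*} [Group G] (N : Subgroup G) [N.FiniteIndex]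
    (hN : N.FG) : Group.FG G := by
  obtain ⟨S, hS⟩ := hN
  obtain ⟨r, hr⟩ : ∃ r : G ⧸ N → G, ∀ g : G, (r g)⁻¹ * g ∈ N :=
    ⟨Quotient.out, fun g ↦ QuotientGroup.eq.1 (QuotientGroup.out_eq' _)⟩
  have : Finite (G ⧸ N) := Subgroup.finite_quotient_of_finiteIndex
  refine Group.fg_iff.2 ⟨S ∪ Set.range r, ?_, S.finite_toSet.union (Set.finite_range r)⟩
  refine eq_top_iff.2 fun g _ ↦ ?_
  have hout : r g ∈ Subgroup.closure (S ∪ Set.range r) :=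
    Subgroup.subset_closure (Or.inr (Set.mem_range_self _))
  have h := mul_mem hout (Subgroup.closure_mono Set.subset_union_left (hS.ge (hr g)))
  rwa [mul_inv_cancel_left] at h

/-- If a group generated by `n` elements maps onto a finite index subgroup of a free group, the
rank of the free group is at most `n`. -/
theorem FreeGroup.mk_le_of_finiteIndex_range {α H : Type*} [Group H] {n : ℕ} (v : Fin n → H)
    (hv : Subgroup.closure (Set.range v) = ⊤) (f : H →* FreeGroup α) (hf : f.range.FiniteIndex) :
    Cardinal.mk α ≤ n := by
  classical
  let φ (c : α → ℚ) : FreeGroup α →* Multiplicative ℚ :=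
    FreeGroup.lift fun a ↦ Multiplicative.ofAdd (c a)
  let x (a : α) (i : Fin n) : ℚ := (φ (Pi.single a 1) (f (v i))).toAdd
  have key : LinearIndependent ℚ x := by
    rw [linearIndependent_iff']
    intro s g hg a ha
    let c : α → ℚ := ∑ b ∈ s, g b • Pi.single b 1
    have hφ (w : FreeGroup α) :
        (φ c w).toAdd = ∑ b ∈ s, g b * (φ (Pi.single b 1) w).toAdd := by
      induction w using FreeGroup.induction_on with
      | C1 => simp
      | of b => simp [φ, c, Finset.sum_apply]
      | inv_of b h =>
        simp only [_root_.map_inv, toAdd_inv, h, mul_neg, Finset.sum_neg_distrib]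
      | mul y z hy hz => simp only [_root_.map_mul, toAdd_mul, hy, hz, mul_add, Finset.sum_add_distrib]
    have htriv : (φ c).comp f = 1 := by
      refine MonoidHom.eq_of_eqOn_dense hv ?_
      rintro _ ⟨i, rfl⟩
      apply Multiplicative.toAdd.injective
      simpa [hφ, x] using congrFun hg i
    obtain ⟨k, hk, -, h, hh⟩ := Subgroup.exists_pow_mem_of_index_ne_zero hf.index_ne_zero (of a)
    have h1 : φ c (of a) ^ k = 1 := by
      rw [← map_pow, ← hh]
      exact DFunLike.congr_fun htriv h
    have h2 := congrArg Multiplicative.toAdd h1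
    have hca : c a = g a := by simp [c, Finset.sum_apply, Pi.single_apply, ha]
    simpa [φ, hca, hk.ne'] using h2
  simpa using key.cardinal_lift_le_rank

theorem few_generators_normallyIncommensurable_freeGroup (α : Type*)
    (hα : 2 ≤ Cardinal.mk α) (H : Type*) [Group H] (n : ℕ)
    (hn : (n : Cardinal) < Cardinal.mk α)
    (hgen : ∃ f : Fin n → H, Subgroup.closure (Set.range f) = ⊤) :
    NormallyIncommensurable H (FreeGroup α) := by
  rintro ⟨f, K, hf, hK, hle, hN⟩
  obtain ⟨v, hv⟩ := hgen
  have : Group.FG H := Group.fg_iff.2 ⟨_, hv, Set.finite_range v⟩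
  have hfg : Group.FG f.range := inferInstance
  have hne : f.range ≠ ⊥ := by rwa [Ne, MonoidHom.range_eq_bot_iff]
  have hfgK : (f.range.subgroupOf K).FG := by
    rw [← Group.fg_iff_subgroup_fg]
    exact Group.fg_of_surjective (f := (Subgroup.subgroupOfEquivOfLe hle).symm.toMonoidHom)
      (Subgroup.subgroupOfEquivOfLe hle).symm.surjective
  have hneK : f.range.subgroupOf K ≠ ⊥ := by
    rw [Ne, Subgroup.subgroupOf_eq_bot, disjoint_iff, inf_eq_left.2 hle]
    exact hne
  have hfin := IsFreeGroup.finiteIndex_of_normal_of_fg hN hneK hfgK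
  have hKfg : K.FG := (Group.fg_iff_subgroup_fg K).1 (Group.fg_of_finiteIndex _ hfgK)
  have hKfin := FreeGroup.finiteIndex_of_normal_of_fg hK (ne_bot_of_le_ne_bot hne hle) hKfg
  refine hn.not_ge (FreeGroup.mk_le_of_finiteIndex_range v hv f ⟨?_⟩)
  rw [← Subgroup.relIndex_mul_index hle]
  exact mul_ne_zero hfin.index_ne_zero hKfin.index_ne_zero
end

section
/- Let G₁ and G₂ be nontrivial, finitely generated, residually finite groups such that G₂ is not isomorphic to ℤ/2ℤ and the free product G₁ ∗ G₂ is not perfect. Then G₁ ∗ G₂ is perfectly-Hopfian. -/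
/-- A group is residually finite if every nontrivial element is mapped nontrivially
in some finite quotient group. -/
def ResiduallyFinite (G : Type*) [Group G] : Prop :=
  ∀ g : G, g ≠ 1 → ∃ (Q : Type) (_ : Group Q) (_ : Finite Q) (f : G →* Q),
    Function.Surjective f ∧ f g ≠ 1

open Monoid

open scoped Classical in
/-- A group action on `X` induces an action on any subset `S` of `X`: points whose orbit is not
contained in `S` are fixed. -/
@[reducible]
noncomputable def truncatedMulAction (P : Type*) {X : Type*} [Group P] [MulAction P X]
    (S : Set X) : MulAction P S :=
  letI : SMul P S :=
    ⟨fun p x => if h : ∀ q : P, q • (x : X) ∈ S then ⟨p • (x : X), h p⟩ else x⟩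
  have smul_def (p : P) (x : S) :
      p • x = if h : ∀ q : P, q • (x : X) ∈ S then ⟨p • (x : X), h p⟩ else x := rfl
  { one_smul := fun x => by
      rw [smul_def]
      split_ifs <;> simp
    mul_smul := fun p q x => by
      by_cases h : ∀ q : P, q • (x : X) ∈ S
      · have hx : ((q • x : S) : X) = q • (x : X) := by rw [smul_def, dif_pos h]
        have h' : ∀ r : P, r • ((q • x : S) : X) ∈ S := fun r => by
          rw [hx, ← mul_smul]
          exact h _
        rw [smul_def p, dif_pos h', smul_def, dif_pos h]
        simp [hx, mul_smul]
      · have hx : q • x = x := by rw [smul_def, dif_neg h]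
        rw [hx, smul_def, dif_neg h, smul_def, dif_neg h] }

theorem truncatedMulAction_coe_smul {P X : Type*} [Group P] [MulAction P X] {S : Set X} (p : P)
    (x : S) (h : ∀ q : P, q • (x : X) ∈ S) :
    letI := truncatedMulAction P S
    ((p • x : S) : X) = p • (x : X) := by
  classical
  exact congrArg Subtype.val (dif_pos h)

namespace Monoid.CoprodI

variable {ι : Type*} {G : ι → Type*} [∀ i, Group (G i)]

theorem exists_list_prod_eq (x : CoprodI G) :
    ∃ l : List (Σ i, G i), (l.map fun a => (of a.2 : CoprodI G)).prod = x := by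
  classical
  exact ⟨(Word.equiv x).toList, Word.equiv.symm_apply_apply x⟩

theorem residuallyFinite_of_finite [∀ i, Finite (G i)] : Group.ResiduallyFinite (CoprodI G) := by
  refine Group.residuallyFinite_of_forall_exists_finite_monoidHom fun w hw => ?_
  obtain ⟨l, rfl⟩ := exists_list_prod_eq w
  set pr : List (Σ i, G i) → CoprodI G := fun l => (l.map fun a => of a.2).prod with hpr
  obtain ⟨S, hfin, h1, hS⟩ : ∃ S : Set (CoprodI G), S.Finite ∧ 1 ∈ S ∧
      ∀ a t, a :: t <:+ l → ∀ q : G a.1, of q * pr t ∈ S := by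
    clear hw
    induction l with
    | nil => exact ⟨{1}, Set.finite_singleton _, rfl, by simp⟩
    | cons b l ih =>
      obtain ⟨S, hfin, h1, hS⟩ := ih
      refine ⟨S ∪ Set.range fun q : G b.1 => of q * pr l, hfin.union (Set.finite_range _),
        Or.inl h1, fun a t hat q => ?_⟩
      rcases List.suffix_cons_iff.1 hat with h | h
      · obtain ⟨rfl, rfl⟩ := List.cons.inj h
        exact Or.inr ⟨q, rfl⟩
      · exact Or.inl (hS a t h q)
  have := hfin.to_subtype
  let (i : ι) : MulAction (G i) (CoprodI G) := MulAction.compHom _ (of : G i →* CoprodI G)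
  let (i : ι) : MulAction (G i) S := truncatedMulAction (G i) S
  let Θ : CoprodI G →* Equiv.Perm S := lift fun i => MulAction.toPermHom (G i) S
  have key : ∀ t, t <:+ l → ((Θ (pr t) ⟨1, h1⟩ : S) : CoprodI G) = pr t := by
    intro t
    induction t with
    | nil => simp [hpr]
    | cons a t ih =>
      intro ht
      have ht' := ih ((List.suffix_cons a t).trans ht)
      have : pr (a :: t) = of a.2 * pr t := by simp [hpr]
      rw [this, map_mul, Equiv.Perm.mul_apply]
      simp only [Θ, lift_of, MulAction.toPermHom_apply, MulAction.toPerm_apply]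
      rw [truncatedMulAction_coe_smul]
      · exact congrArg (of a.2 * ·) ht'
      · intro q
        have := hS a t ht q
        rw [← ht'] at this
        exact this
  refine ⟨Equiv.Perm S, inferInstance, inferInstance, Θ, fun h => hw ?_⟩
  have := key l List.suffix_rfl
  change Θ (pr l) = 1 at h
  rw [h] at this
  exact this.symm

theorem prod_map_word_ne_one {Q : ι → Type*} [∀ i, Group (Q i)] (f : ∀ i, G i →* Q i)
    (w : Word G) (hw : w ≠ Word.empty) (hf : ∀ a ∈ w.toList, f a.1 a.2 ≠ 1) :
    lift (fun i => (of : Q i →* CoprodI Q).comp (f i)) w.prod ≠ 1 := by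
  classical
  let w' : Word Q :=
    { toList := w.toList.map fun a => ⟨a.1, f a.1 a.2⟩
      ne_one := by
        simp only [List.mem_map]
        rintro _ ⟨a, ha, rfl⟩
        exact hf a ha
      chain_ne := by
        rw [List.isChain_map]
        exact w.chain_ne }
  have h : lift (fun i => (of : Q i →* CoprodI Q).comp (f i)) w.prod = w'.prod := by
    simp [Word.prod, w', map_list_prod, List.map_map, Function.comp_def]
  rw [h, ← Word.prod_empty]
  intro h'
  have : w' = Word.empty := Word.equiv.symm.injective h'
  have := congrArg Word.toList this
  simp only [w', Word.empty_toList, List.map_eq_nil_iff] at this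
  exact hw (Word.ext this)

instance residuallyFinite [∀ i, Group.ResiduallyFinite (G i)] :
    Group.ResiduallyFinite (CoprodI G) := by
  classical
  rw [Group.residuallyFinite_iff_exists_finiteIndex]
  intro x hx
  set w := Word.equiv x with hwx
  have hprod : w.prod = x := Word.equiv.symm_apply_apply x
  have hne : w ≠ Word.empty := fun h => hx (by rw [← hprod, h, Word.prod_empty])
  choose K hK using fun a : w.toList.toFinset =>
    Group.exists_finiteIndexNormalSubgroup_notMem a.1.2 (w.ne_one _ (List.mem_toFinset.1 a.2))
  let L (i : ι) : Subgroup (G i) :=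
    ⨅ a : w.toList.toFinset, if h : a.1.1 = i then h ▸ (K a).toSubgroup else ⊤
  have hLn (i) : (L i).Normal := Subgroup.normal_iInf_normal fun a => by
    split_ifs with h
    · subst h; exact (K a).isNormal'
    · infer_instance
  have hLf (i) : (L i).FiniteIndex := Subgroup.finiteIndex_iInf fun a => by
    split_ifs with h
    · subst h; exact (K a).isFiniteIndex'
    · infer_instance
  have hne' := prod_map_word_ne_one (fun i => QuotientGroup.mk' (L i)) w hne fun a ha h => by
    have h' : a.2 ∈ L a.1 := (QuotientGroup.eq_one_iff _).1 h
    have := (Subgroup.mem_iInf.1 h') ⟨a, List.mem_toFinset.2 ha⟩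
    rw [dif_pos rfl] at this
    exact hK ⟨a, List.mem_toFinset.2 ha⟩ this
  have := residuallyFinite_of_finite (G := fun i => G i ⧸ L i)
  obtain ⟨H, hH⟩ := Group.exists_finiteIndexNormalSubgroup_notMem _ hne'
  refine ⟨H.toSubgroup.comap (lift fun i => of.comp (QuotientGroup.mk' (L i))), ?_, ?_⟩
  · exact (H.comap _).isFiniteIndex'
  · rw [hprod] at hH
    exact hH

open scoped Classical in
/-- The index of the first letter of the reduced word representing an element of a free product. -/
noncomputable def firstIdx (x : CoprodI G) : Option ι :=
  (Word.equiv x).fstIdx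

@[simp]
theorem firstIdx_one : firstIdx (1 : CoprodI G) = none := by
  classical
  simp [firstIdx, Word.equiv, Word.fstIdx]

theorem firstIdx_of_mul {i : ι} {g : G i} (hg : g ≠ 1) {y : CoprodI G}
    (hy : firstIdx y ≠ some i) : firstIdx (of g * y) = some i := by
  classical
  have hy' : (Word.equiv y).fstIdx ≠ some i := hy
  have : Word.equiv (of g * y) = Word.cons g (Word.equiv y) hy' hg := by
    rw [Word.cons_eq_smul]
    exact mul_smul (of g) y (Word.empty : Word G)
  rw [firstIdx, this, Word.fstIdx_cons]

theorem firstIdx_of {i : ι} {g : G i} (hg : g ≠ 1) : firstIdx (of g : CoprodI G) = some i := by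
  simpa using firstIdx_of_mul hg (y := 1) (by simp)

@[elab_as_elim]
theorem reduced_induction {motive : CoprodI G → Prop} (x : CoprodI G) (one : motive 1)
    (of_mul : ∀ (i : ι) (g : G i) (y : CoprodI G), g ≠ 1 → firstIdx y ≠ some i → motive y →
      motive (of g * y)) : motive x := by
  classical
  suffices h : ∀ w : Word G, motive w.prod by
    simpa using (Word.equiv.symm_apply_apply x) ▸ h (Word.equiv x)
  intro w
  induction w using Word.consRecOn with
  | empty => exact one
  | cons i m w h1 h2 ih =>
    rw [Word.prod_cons]
    refine of_mul i m _ h2 ?_ ih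
    rwa [firstIdx, show Word.equiv w.prod = w from Word.equiv.apply_symm_apply w]

theorem firstIdx_of_or {i : ι} (g : G i) :
    firstIdx (of g : CoprodI G) = none ∨ firstIdx (of g : CoprodI G) = some i := by
  by_cases hg : g = 1
  · simp [hg]
  · exact Or.inr (firstIdx_of hg)

theorem firstIdx_mul_of {j : ι} (g : G j) (y : CoprodI G)
    (hy : y ∉ (of : G j →* CoprodI G).range) : firstIdx (y * of g) = firstIdx y := by
  induction y using reduced_induction with
  | one => exact absurd (one_mem _) hy
  | of_mul i h y hh hne ih =>
    rw [firstIdx_of_mul hh hne, mul_assoc]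
    refine firstIdx_of_mul hh ?_
    by_cases hy' : y ∈ (of : G j →* CoprodI G).range
    · obtain ⟨k, rfl⟩ := hy'
      rw [← map_mul]
      by_cases hij : j = i
      · subst hij
        exact absurd (mul_mem (MonoidHom.mem_range.2 ⟨h, rfl⟩) (MonoidHom.mem_range.2 ⟨k, rfl⟩)) hy
      · rcases firstIdx_of_or (k * g) with h0 | h0 <;> simp [h0, hij, -map_mul]
    · rwa [ih hy']

/-- Left multiplication by `x` sends every element whose reduced word does not start in `G j` to an
element whose reduced word starts in `G i`. -/
def PingPong (i j : ι) (x : CoprodI G) : Prop :=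
  ∀ y : CoprodI G, firstIdx y ≠ some j → firstIdx (x * y) = some i

theorem pingPong_of {i : ι} {g : G i} (hg : g ≠ 1) : PingPong i i (of g : CoprodI G) :=
  fun _ hy => firstIdx_of_mul hg hy

theorem PingPong.mul {i j k l : ι} {x x' : CoprodI G} (hx : PingPong i j x)
    (hx' : PingPong k l x') (hjk : j ≠ k) : PingPong i l (x * x') := fun y hy => by
  rw [mul_assoc]
  refine hx _ ?_
  rw [hx' y hy]
  simpa using hjk.symm

theorem PingPong.firstIdx {i j : ι} {x : CoprodI G} (hx : PingPong i j x) :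
    firstIdx x = some i := by
  simpa using hx 1 (by simp)

/-- The element `k` in the conclusion is the last letter of the reduced word of `x`. -/
theorem exists_pingPong {x : CoprodI G} (hx : x ≠ 1) :
    ∃ (i j : ι) (k : G j), k ≠ 1 ∧ (∀ t : G j, k * t ≠ 1 → PingPong i j (x * of t)) ∧
      PingPong j i x⁻¹ := by
  induction x using reduced_induction with
  | one => exact absurd rfl hx
  | of_mul i h y hh hne ih =>
    by_cases hy : y = 1
    · subst hy
      refine ⟨i, i, h, hh, fun t ht => ?_, ?_⟩
      · rw [mul_one, ← map_mul]
        exact pingPong_of ht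
      · rw [mul_one, ← map_inv]
        exact pingPong_of (inv_ne_one.2 hh)
    · obtain ⟨i', j, k, hk, hkt, hinv⟩ := ih hy
      have hi' : i ≠ i' := by
        have := (hkt 1 (by simpa using hk)).firstIdx
        rw [map_one, mul_one] at this
        rintro rfl
        exact hne this
      refine ⟨i, j, k, hk, fun t ht => ?_, ?_⟩
      · rw [mul_assoc]
        exact (pingPong_of hh).mul (hkt t ht) hi'
      · rw [mul_inv_rev, ← map_inv]
        exact hinv.mul (pingPong_of (inv_ne_one.2 hh)) hi'.symm

end Monoid.CoprodI

namespace Monoid.CoprodI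

variable {G : Bool → Type*} [∀ b, Group (G b)]

theorem exists_mem_pingPong_of_normal {N : Subgroup (CoprodI G)} [N.Normal] (hN : N ≠ ⊥)
    {a : G false} (ha : a ≠ 1) {b c : G true} (hb : b ≠ 1) (hc : c ≠ 1) (hbc : b ≠ c) :
    ∃ m ∈ N, PingPong false false m := by
  have conj_true {m} (hm : m ∈ N) (h : PingPong true true m) :
      ∃ m ∈ N, PingPong false false m :=
    ⟨of a * m * (of a)⁻¹, Subgroup.Normal.conj_mem ‹_› m hm _,
      ((pingPong_of ha).mul h (by simp)).mul
        (by rw [← map_inv]; exact pingPong_of (inv_ne_one.2 ha)) (by simp)⟩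
  have of_false_true {m} (hm : m ∈ N) (h : PingPong false true m) :
      ∃ m ∈ N, PingPong false false m := by
    obtain ⟨i, j, k, hk, hkt, hinv⟩ := exists_pingPong (x := m) (by
      rintro rfl
      simpa using h.firstIdx)
    have hm' : PingPong i j m := by simpa using hkt 1 (by simpa using hk)
    obtain rfl : i = false := by simpa using hm'.firstIdx.symm.trans h.firstIdx
    obtain rfl | rfl : j = false ∨ j = true := by cases j <;> simp
    · exact ⟨m, hm, hm'⟩
    obtain ⟨t, ht, hkt'⟩ : ∃ t : G true, t ≠ 1 ∧ k * t ≠ 1 := by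
      by_cases hkb : k * b = 1
      · exact ⟨c, hc, fun hkc => hbc (mul_left_cancel (hkb.trans hkc.symm))⟩
      · exact ⟨b, hb, hkb⟩
    refine conj_true (m := (of t)⁻¹ * (m * of t)) ?_ ?_
    · simpa [mul_assoc] using Subgroup.Normal.conj_mem ‹_› m hm (of t)⁻¹
    · rw [← map_inv]
      exact (pingPong_of (inv_ne_one.2 ht)).mul (hkt t hkt') (by simp)
  obtain ⟨m, hm, hm1⟩ := N.bot_or_exists_ne_one.resolve_left hN
  obtain ⟨i, j, k, hk, hkt, hinv⟩ := exists_pingPong hm1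
  have hm' : PingPong i j m := by simpa using hkt 1 (by simpa using hk)
  cases i <;> cases j
  · exact ⟨m, hm, hm'⟩
  · exact of_false_true hm hm'
  · exact of_false_true (N.inv_mem hm) hinv
  · exact conj_true hm hm'

/-- The elements of a free product whose reduced word ends in the second factor. -/
def endsTrue (G : Bool → Type*) [∀ b, Group (G b)] : Set (CoprodI G) :=
  {x | firstIdx x⁻¹ = some true}

theorem mul_inv_notMem_endsTrue {m x : CoprodI G} (hm : PingPong false false m)
    (hx : x ∈ endsTrue G) : x * m⁻¹ ∉ endsTrue G := by
  have hx' : firstIdx x⁻¹ = some true := hx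
  simp [endsTrue, hm x⁻¹ (by simp [hx'])]

theorem mul_of_mem_endsTrue {b : G true} (hb : b ≠ 1) {x : CoprodI G} (hx : x ∉ endsTrue G) :
    x * of b ∈ endsTrue G := by
  change firstIdx (x * of b)⁻¹ = some true
  rw [mul_inv_rev, ← map_inv]
  exact firstIdx_of_mul (inv_ne_one.2 hb) hx

theorem finite_setOf_not_mem_endsTrue_iff (g : CoprodI G) :
    {x | ¬ (x ∈ endsTrue G ↔ g * x ∈ endsTrue G)}.Finite := by
  induction g using CoprodI.induction_on with
  | one => simp
  | of i g =>
    refine Set.Finite.subset (Set.toFinite {1, (of g)⁻¹}) fun x hx => ?_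
    simp only [endsTrue, Set.mem_ofPred_eq, mul_inv_rev, ← map_inv] at hx
    by_cases hmem : x⁻¹ ∈ (of : G i →* CoprodI G).range
    · obtain ⟨y, hy⟩ := hmem
      obtain rfl : x = of y⁻¹ := by rw [map_inv, hy, inv_inv]
      rw [← map_inv, inv_inv, ← map_mul] at hx
      cases i
      · rcases firstIdx_of_or y with h | h <;> rcases firstIdx_of_or (y * g⁻¹) with h' | h' <;>
          simp [h, h', -map_mul, -map_inv] at hx
      · by_cases hy1 : y = 1
        · simp [hy1]
        · by_cases hyg : y * g⁻¹ = 1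
          · rw [mul_inv_eq_one] at hyg
            simp [hyg]
          · simp [firstIdx_of hy1, firstIdx_of hyg, -map_mul, -map_inv] at hx
    · rw [firstIdx_mul_of _ _ hmem] at hx
      exact absurd Iff.rfl hx
  | mul g h hg hh =>
    refine (hh.union (hg.preimage (mul_right_injective h).injOn)).subset fun x hx => ?_
    by_contra hcon
    simp only [Set.mem_union, Set.mem_ofPred_eq, Set.mem_preimage, not_or, not_not] at hcon
    exact hx (by rw [hcon.1, hcon.2, mul_assoc])

theorem infinite_of_ne {a : G false} (ha : a ≠ 1) {b c : G true} (hb : b ≠ 1) (hc : c ≠ 1)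
    (hbc : b ≠ c) : Infinite (CoprodI G) := by
  by_contra hinf
  rw [not_infinite_iff_finite] at hinf
  set B := endsTrue G
  have h1 : B.ncard ≤ Bᶜ.ncard := by
    refine Set.ncard_le_ncard_of_injOn (· * (of a)⁻¹)
      (fun x hx => mul_inv_notMem_endsTrue (pingPong_of ha) hx) (mul_left_injective _).injOn
  have h2 : ((· * of b) '' Bᶜ ∪ (· * of c) '' Bᶜ).ncard ≤ B.ncard := by
    refine Set.ncard_le_ncard ?_
    rintro _ (⟨x, hx, rfl⟩ | ⟨x, hx, rfl⟩)
    · exact mul_of_mem_endsTrue hb hx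
    · exact mul_of_mem_endsTrue hc hx
  have hdisj : Disjoint ((· * (of b : CoprodI G)) '' Bᶜ) ((· * (of c : CoprodI G)) '' Bᶜ) := by
    rw [Set.disjoint_left]
    rintro _ ⟨x, hx, rfl⟩ ⟨y, hy, hxy⟩
    have hxy : y * of c = x * of b := hxy
    refine hx ?_
    have : x = y * of (c * b⁻¹) := by rw [map_mul, ← mul_assoc, hxy]; simp
    rw [this]
    exact mul_of_mem_endsTrue (fun h => hbc (mul_inv_eq_one.1 h).symm) hy
  rw [Set.ncard_union_eq hdisj, Set.ncard_image_of_injective _ (mul_left_injective _),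
    Set.ncard_image_of_injective _ (mul_left_injective _)] at h2
  have h3 : Bᶜ.ncard = 0 := by omega
  rw [Set.ncard_eq_zero] at h3
  have : (1 : CoprodI G) ∈ Bᶜ := by simp [B, endsTrue]
  simp [h3] at this

theorem finiteIndex_of_normal_of_fg {N : Subgroup (CoprodI G)} [N.Normal] (hN : N ≠ ⊥)
    (hfg : N.FG) {a : G false} (ha : a ≠ 1) {b c : G true} (hb : b ≠ 1) (hc : c ≠ 1)
    (hbc : b ≠ c) : N.FiniteIndex := by
  by_contra hfin
  rw [Subgroup.finiteIndex_iff_finite_quotient, not_finite_iff_infinite] at hfin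
  let D (g : CoprodI G) : Set (CoprodI G) := {x | ¬ (x ∈ endsTrue G ↔ g * x ∈ endsTrue G)}
  obtain ⟨T, hT⟩ := hfg
  let F : Set (CoprodI G ⧸ N) := ⋃ s ∈ T, QuotientGroup.mk '' D s
  have hF : F.Finite := Set.Finite.biUnion T.finite_toSet fun s _ =>
    (finite_setOf_not_mem_endsTrue_iff s).image _
  have hmk (n : CoprodI G) (hn : n ∈ N) (x : CoprodI G) :
      ((n * x : CoprodI G) : CoprodI G ⧸ N) = x := by
    rw [QuotientGroup.mk_mul, (QuotientGroup.eq_one_iff n).2 hn, one_mul]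
  have hD : ∀ n ∈ N, ∀ x ∈ D n, (x : CoprodI G ⧸ N) ∈ F := by
    intro n hn
    rw [← hT] at hn
    induction hn using Subgroup.closure_induction with
    | mem s hs => exact fun x hx => Set.mem_biUnion hs ⟨x, hx, rfl⟩
    | one => exact fun x hx => absurd (by rw [one_mul]) hx
    | mul n m hn hm ihn ihm =>
      intro x hx
      by_cases hx' : x ∈ D m
      · exact ihm x hx'
      · rw [← hmk m (hT ▸ hm)]
        refine ihn _ fun h => hx ?_
        rw [not_not.1 hx', h, mul_assoc]
    | inv n hn ih =>
      intro x hx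
      rw [← hmk n⁻¹ (hT ▸ inv_mem hn)]
      refine ih _ fun h => hx ?_
      rw [h, mul_inv_cancel_left]
  obtain ⟨m, hm, hpp⟩ := exists_mem_pingPong_of_normal hN ha hb hc hbc
  have hB : ∀ x ∈ endsTrue G, (x : CoprodI G ⧸ N) ∈ F := by
    intro x hx
    refine hD (x * m⁻¹ * x⁻¹) (Subgroup.Normal.conj_mem ‹_› _ (inv_mem hm) x) x fun h => ?_
    exact mul_inv_notMem_endsTrue hpp hx (by simpa using h.1 hx)
  obtain ⟨q, hq⟩ := (hF.union (hF.preimage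
    (mul_left_injective (QuotientGroup.mk (of b) : CoprodI G ⧸ N)).injOn)).exists_notMem
  obtain ⟨x, rfl⟩ := QuotientGroup.mk_surjective q
  refine hq ?_
  by_cases hx : x ∈ endsTrue G
  · exact Or.inl (hB x hx)
  · exact Or.inr (hB _ (mul_of_mem_endsTrue hb hx))

end Monoid.CoprodI

/-- Crossed homomorphisms on `Γ` with values in the functions on `(Γ ⧸ ψ.range) × Z` are determined
up to principal ones by their restriction along `ψ`, evaluated at the base coset. -/
theorem exists_forall_eq_div_of_crossedHom {Γ Δ Z A : Type*} [Group Γ] [Group Δ] [CommGroup A]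
    [MulAction Γ Z] {S : Set Δ} (hS : Subgroup.closure S = ⊤) (ψ : Δ →* Γ)
    (z : Γ → (Γ ⧸ ψ.range) × Z → A)
    (hz : ∀ g h x, z (g * h) x = z g x * z h (g⁻¹ • x))
    (hzS : ∀ s ∈ S, ∀ p, z (ψ s) (((1 : Γ) : Γ ⧸ ψ.range), p) = 1) :
    ∃ u : (Γ ⧸ ψ.range) × Z → A, ∀ g x, z g x = u x / u (g⁻¹ • x) := by
  have hz1 (x) : z 1 x = 1 := by simpa using hz 1 1 x
  have hfix (d : Δ) (p : Z) :
      ψ d • (((1 : Γ) : Γ ⧸ ψ.range), p) = (((1 : Γ) : Γ ⧸ ψ.range), ψ d • p) := by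
    refine Prod.ext ?_ rfl
    change ((ψ d * 1 : Γ) : Γ ⧸ ψ.range) = _
    rw [eq_comm, QuotientGroup.eq]
    simp
  have hψ : ∀ d : Δ, ∀ p, z (ψ d) (((1 : Γ) : Γ ⧸ ψ.range), p) = 1 := by
    intro d
    have hd : d ∈ Subgroup.closure S := hS ▸ Subgroup.mem_top d
    induction hd using Subgroup.closure_induction with
    | mem s hs => exact hzS s hs
    | one => simp [hz1]
    | mul d e _ _ hd he =>
      intro p
      rw [map_mul, hz, hd, ← map_inv, hfix, he, one_mul]
    | inv d _ hd =>
      intro p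
      have := hz (ψ d) (ψ d)⁻¹ (((1 : Γ) : Γ ⧸ ψ.range), ψ d • p)
      rw [mul_inv_cancel, hz1, hd, one_mul, ← map_inv, hfix, map_inv, inv_smul_smul] at this
      rw [map_inv, ← this]
  let u : (Γ ⧸ ψ.range) × Z → A := fun x => z x.1.out x
  have hu (a : Γ) (p : Z) : u ((a : Γ ⧸ ψ.range), p) = z a ((a : Γ ⧸ ψ.range), p) := by
    obtain ⟨⟨_, d, rfl⟩, hd⟩ := QuotientGroup.mk_out_eq_mul ψ.range a
    have h1 : a⁻¹ • ((a : Γ ⧸ ψ.range), p) = (((1 : Γ) : Γ ⧸ ψ.range), a⁻¹ • p) :=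
      Prod.ext (congrArg QuotientGroup.mk (inv_mul_cancel a)) rfl
    simp only [u, hd]
    rw [hz, h1, hψ, mul_one]
  refine ⟨u, fun g x => ?_⟩
  obtain ⟨y, p⟩ := x
  obtain ⟨a, rfl⟩ := QuotientGroup.mk_surjective y
  have h1 : g⁻¹ • ((a : Γ ⧸ ψ.range), p) = (((g⁻¹ * a : Γ) : Γ ⧸ ψ.range), g⁻¹ • p) := rfl
  rw [h1, hu, hu, ← h1, eq_div_iff_mul_eq', ← hz, mul_inv_cancel_left]

namespace Monoid.CoprodI

variable {G : Bool → Type*} [∀ b, Group (G b)]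

theorem exists_crossedHom {X A : Type*} [CommGroup A] [MulAction (CoprodI G) X] (w : X → A) :
    ∃ z : CoprodI G → X → A, (∀ g h x, z (g * h) x = z g x * z h (g⁻¹ • x)) ∧
      (∀ (g : G false) x, z (of g) x = 1) ∧
      ∀ (g : G true) x, z (of g) x = w x / w ((of g : CoprodI G)⁻¹ • x) := by
  let σ : CoprodI G →* (X → A) ⋊[mulAutArrow] CoprodI G := lift fun b => match b with
    | false => SemidirectProduct.inr.comp of
    | true => (MulAut.conj (SemidirectProduct.inl w)).toMonoidHom.comp
        (SemidirectProduct.inr.comp of)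
  have hσ (g) : (σ g).right = g := by
    have : SemidirectProduct.rightHom.comp σ = MonoidHom.id _ := by
      ext b g
      cases b <;> simp [σ]
    exact DFunLike.congr_fun this g
  refine ⟨fun g => (σ g).left, fun g h x => ?_, fun g x => ?_, fun g x => ?_⟩
  · simp only [map_mul, SemidirectProduct.mul_left, hσ]
    rfl
  · simp [σ]
  · simp only [σ, lift_of]
    simp [div_eq_mul_inv]
    rfl

/-- A bound on the index of the image of an endomorphism of a free product, coming from a count of
crossed homomorphisms. -/
theorem index_range_mul_le {P Q : Type*} [Group P] [Group Q] [Finite P] [Finite Q]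
    {f : G false →* P} (hf : Function.Surjective f) {f' : G true →* Q}
    (hf' : Function.Surjective f') {S : Finset (CoprodI G)}
    (hS : Subgroup.closure (S : Set (CoprodI G)) = ⊤) (ψ : CoprodI G →* CoprodI G)
    [ψ.range.FiniteIndex] :
    ψ.range.index * (Nat.card P * Nat.card Q) ≤ S.card * (Nat.card P * Nat.card Q) +
      ψ.range.index * Nat.card Q + ψ.range.index * Nat.card P := by
  let π : CoprodI G →* P := lift fun b => match b with
    | false => f
    | true => 1
  let π' : CoprodI G →* Q := lift fun b => match b with
    | false => 1
    | true => f'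
  have hπ (g : G false) : π (of g) = f g := by simp [π]
  have hπ₁ (g : G true) : π (of g) = 1 := by simp [π]
  have hπ' (g : G true) : π' (of g) = f' g := by simp [π']
  have hπ'₁ (g : G false) : π' (of g) = 1 := by simp [π']
  let : MulAction (CoprodI G) P := MulAction.compHom P π
  let : MulAction (CoprodI G) Q := MulAction.compHom Q π'
  have hsmul (g : CoprodI G) (p : P) : g • p = π g * p := rfl
  have hsmul' (g : CoprodI G) (q : Q) : g • q = π' g * q := rfl
  let Y := CoprodI G ⧸ ψ.range
  let X := Y × P × Q
  choose z hz hz₀ hz₁ using fun w : X → ℤˣ => exists_crossedHom (G := G) w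
  let F : (X → ℤˣ) → (S × P × Q → ℤˣ) := fun w a => z w (ψ a.1) (((1 : CoprodI G) : Y), a.2)
  have hF : ∀ w w' : X → ℤˣ, F w = F w' → ∃ u : X → ℤˣ,
      (∀ (g : G false) x, u ((of g : CoprodI G)⁻¹ • x) = u x) ∧
      ∀ (g : G true) x, (w / w' / u) ((of g : CoprodI G)⁻¹ • x) = (w / w' / u) x := by
    intro w w' h
    obtain ⟨u, hu⟩ := exists_forall_eq_div_of_crossedHom hS ψ (fun g => z w g / z w' g)
      (fun g h x => by simp only [Pi.div_apply, hz, mul_div_mul_comm])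
      (fun s hs p => div_eq_one.2 (congrFun h (⟨s, hs⟩, p)))
    refine ⟨u, fun g x => ?_, fun g x => ?_⟩
    · have := hu (of g) x
      rw [Pi.div_apply, hz₀, hz₀, div_one, eq_comm, div_eq_one] at this
      exact this.symm
    · have := hu (of g) x
      rw [Pi.div_apply, hz₁, hz₁] at this
      simp only [Pi.div_apply]
      rw [div_div_div_comm, div_eq_div_iff_mul_eq_mul] at this
      rw [div_eq_div_iff_mul_eq_mul, mul_comm _ (u x), ← this]
  choose! u hu₀ hu₁ using hF
  let r : (S × P × Q → ℤˣ) → (X → ℤˣ) := Function.invFun F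
  have hr (w) : F w = F (r (F w)) := (Function.invFun_eq ⟨w, rfl⟩).symm
  let J : (X → ℤˣ) → (S × P × Q → ℤˣ) × (Y × Q → ℤˣ) × (Y × P → ℤˣ) := fun w =>
    (F w, fun a => u w (r (F w)) (a.1, 1, a.2),
      fun a => (w / r (F w) / u w (r (F w))) (a.1, a.2, 1))
  have hJ : Function.Injective J := by
    intro w w' h
    obtain ⟨h1, h2⟩ := Prod.ext_iff.1 h
    obtain ⟨h2, h3⟩ := Prod.ext_iff.1 h2
    have h1 : F w = F w' := h1
    have hr' : F w' = F (r (F w)) := h1.symm.trans (hr w)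
    have e2 : u w (r (F w)) = u w' (r (F w)) := by
      funext ⟨y, p, q⟩
      obtain ⟨g, rfl⟩ := hf p
      have key : (of g : CoprodI G)⁻¹ • (y, f g, q) = ((of g : CoprodI G)⁻¹ • y, (1 : P), q) := by
        simp [Prod.smul_mk, hsmul, hsmul', hπ, hπ'₁]
      rw [← hu₀ _ _ (hr w) g, ← hu₀ _ _ hr' g, key]
      have := congrFun h2 ((of g : CoprodI G)⁻¹ • y, q)
      simp only [J, ← h1] at this
      exact this
    have e3 : w / r (F w) / u w (r (F w)) = w' / r (F w) / u w' (r (F w)) := by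
      funext ⟨y, p, q⟩
      obtain ⟨g, rfl⟩ := hf' q
      have key : (of g : CoprodI G)⁻¹ • (y, p, f' g) = ((of g : CoprodI G)⁻¹ • y, p, (1 : Q)) := by
        simp [Prod.smul_mk, hsmul, hsmul', hπ', hπ₁]
      rw [← hu₁ _ _ (hr w) g, ← hu₁ _ _ hr' g, key]
      have := congrFun h3 ((of g : CoprodI G)⁻¹ • y, p)
      simp only [J, ← h1] at this
      exact this
    rw [e2] at e3
    simpa using e3
  have hcard := Nat.card_le_card_of_injective J hJ
  have hY : Nat.card Y = ψ.range.index := rfl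
  have h2 : Nat.card ℤˣ = 2 := by simp
  simp only [Nat.card_prod, Nat.card_fun, X, hY, h2, Nat.card_eq_fintype_card (α := S),
    Fintype.card_coe, ← pow_add] at hcard
  have := (Nat.pow_le_pow_iff_right (by norm_num)).1 hcard
  linarith

end Monoid.CoprodI

theorem MonoidHom.finite_of_fg {G Q : Type*} [Group G] [Group Q] [Group.FG G] [Finite Q] :
    Finite (G →* Q) := by
  obtain ⟨S, hS⟩ := Group.fg_def.1 ‹Group.FG G›
  refine Finite.of_injective (fun (f : G →* Q) (s : S) => f s) fun f g h => ?_
  exact MonoidHom.eq_of_eqOn_dense hS fun s hs => congrFun h ⟨s, hs⟩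

/-- Malcev's theorem: finitely generated residually finite groups are Hopfian. -/
theorem Group.ResiduallyFinite.injective_of_surjective {G : Type*} [Group G] [Group.FG G]
    [Group.ResiduallyFinite G] {φ : G →* G} (hφ : Function.Surjective φ) :
    Function.Injective φ := by
  refine (injective_iff_map_eq_one φ).2 fun g hg => ?_
  refine Group.eq_one_iff_forall_finiteIndexNormalSubroup g fun H => ?_
  have : Finite (G →* G ⧸ H.toSubgroup) := MonoidHom.finite_of_fg
  have hinj : Function.Injective fun f : G →* G ⧸ H.toSubgroup => f.comp φ :=
    fun f f' h => (MonoidHom.cancel_right hφ).1 h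
  obtain ⟨f, hf⟩ := Finite.surjective_of_injective hinj (QuotientGroup.mk' H.toSubgroup)
  have := DFunLike.congr_fun hf g
  rw [MonoidHom.comp_apply, hg, map_one] at this
  exact (QuotientGroup.eq_one_iff g).1 this.symm

theorem Subgroup.finite_of_disjoint_finiteIndex {G : Type*} [Group G] {H K : Subgroup G}
    [K.FiniteIndex] (h : Disjoint H K) : Finite H := by
  refine Finite.of_injective (fun x : H => ((x : G) : G ⧸ K)) fun x y hxy => ?_
  have := h.le_bot ⟨H.mul_mem (H.inv_mem x.2) y.2, QuotientGroup.eq.1 hxy⟩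
  exact Subtype.ext (inv_mul_eq_one.1 (Subgroup.mem_bot.1 this))

/-- The images of the iterates of an endomorphism form a strictly decreasing sequence of subgroups
until they stabilize, so they stabilize if their indices are finite and bounded. -/
theorem Subgroup.exists_map_iterate_eq_of_index_le {G : Type*} [Group G] {φ : G →* G} {C : ℕ}
    (hfi : φ.range.FiniteIndex)
    (hC : ∀ ψ : G →* G, ψ.range.FiniteIndex → ψ.range.index ≤ C) :
    ∃ ψ : G →* G, ψ.range.FiniteIndex ∧ ψ.range.map φ = ψ.range := by
  let ψ (k : ℕ) : G →* G := k.rec (MonoidHom.id G) fun _ f => φ.comp f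
  have hzero : (ψ 0).range = ⊤ := MonoidHom.range_eq_top.2 Function.surjective_id
  have hsucc (k) : (ψ (k + 1)).range = (ψ k).range.map φ := MonoidHom.range_comp _ _
  have hfin (k) : (ψ k).range.FiniteIndex := by
    induction k with
    | zero => rw [hzero]; infer_instance
    | succ k ih =>
      have := finiteIndex_of_le (le_sup_left : (ψ k).range ≤ _ ⊔ φ.ker)
      refine ⟨?_⟩
      rw [hsucc, index_map]
      exact mul_ne_zero this.index_ne_zero hfi.index_ne_zero
  have hle (k) : (ψ (k + 1)).range ≤ (ψ k).range := by
    induction k with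
    | zero => rw [hzero]; exact le_top
    | succ k ih =>
      rw [hsucc k, hsucc (k + 1)]
      exact map_mono ih
  by_contra! h
  have hmono : StrictMono fun k => (ψ k).range.index := strictMono_nat_of_lt_succ fun k =>
    have := hfin (k + 1)
    index_strictAnti ((hle k).lt_of_ne (hsucc k ▸ h (ψ k) (hfin k)))
  have := (hmono.le_apply (x := C + 1)).trans (hC _ (hfin (C + 1)))
  omega

namespace Monoid.CoprodI

variable {G : Bool → Type*} [∀ b, Group (G b)]

theorem fg {ι : Type*} [Finite ι] {G : ι → Type*} [∀ i, Group (G i)] [∀ i, Group.FG (G i)] :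
    Group.FG (CoprodI G) := by
  have h := range_eq_iSup G fun i => of
  have hid : lift (fun i => (of : G i →* CoprodI G)) = MonoidHom.id _ := by ext; simp
  rw [hid, MonoidHom.range_eq_top.2 Function.surjective_id] at h
  rw [Group.fg_def, h]
  exact Subgroup.FG.iSup _ fun i => (Group.fg_iff_subgroup_fg _).1 inferInstance

theorem exists_index_range_le [∀ b, Group.FG (G b)] [∀ b, Group.ResiduallyFinite (G b)]
    {a : G false} (ha : a ≠ 1) {b c : G true} (hb : b ≠ 1) (hc : c ≠ 1) (hbc : b ≠ c) :
    ∃ C : ℕ, ∀ ψ : CoprodI G →* CoprodI G, ψ.range.FiniteIndex → ψ.range.index ≤ C := by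
  obtain ⟨A, hA⟩ := Group.exists_finiteIndexNormalSubgroup_notMem a ha
  obtain ⟨B₁, hB₁⟩ := Group.exists_finiteIndexNormalSubgroup_notMem b hb
  obtain ⟨B₂, hB₂⟩ := Group.exists_finiteIndexNormalSubgroup_notMem c hc
  obtain ⟨B₃, hB₃⟩ := Group.exists_finiteIndexNormalSubgroup_notMem (b⁻¹ * c)
    (mt inv_mul_eq_one.1 hbc)
  let B := B₁ ⊓ B₂ ⊓ B₃
  have hP : 1 < Nat.card (G false ⧸ A.toSubgroup) :=
    Finite.one_lt_card_iff_nontrivial.2 ⟨_, _, mt (QuotientGroup.eq_one_iff a).1 hA⟩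
  have hQ : 2 < Nat.card (G true ⧸ B.toSubgroup) := by
    have := Fintype.ofFinite (G true ⧸ B.toSubgroup)
    rw [Nat.card_eq_fintype_card, Fintype.two_lt_card_iff]
    refine ⟨1, b, c, ?_, ?_, ?_⟩
    · exact fun h => hB₁ ((QuotientGroup.eq_one_iff b).1 h.symm).1.1
    · exact fun h => hB₂ ((QuotientGroup.eq_one_iff c).1 h.symm).1.2
    · exact fun h => hB₃ (QuotientGroup.eq.1 h).2
  obtain ⟨S, hS⟩ := Group.fg_def.1 (fg (G := G))
  refine ⟨S.card * (Nat.card (G false ⧸ A.toSubgroup) * Nat.card (G true ⧸ B.toSubgroup)),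
    fun ψ hψ => ?_⟩
  have h := index_range_mul_le (QuotientGroup.mk'_surjective A.toSubgroup)
    (QuotientGroup.mk'_surjective B.toSubgroup) hS ψ
  generalize Nat.card (G false ⧸ A.toSubgroup) = p at *
  generalize Nat.card (G true ⧸ B.toSubgroup) = q at *
  have hpq : p + q + 1 ≤ p * q := by nlinarith
  nlinarith [Nat.mul_le_mul_left ψ.range.index hpq]

theorem bijective_of_normal_range [∀ b, Group.FG (G b)] [∀ b, Group.ResiduallyFinite (G b)]
    {a : G false} (ha : a ≠ 1) {b c : G true} (hb : b ≠ 1) (hc : c ≠ 1) (hbc : b ≠ c)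
    {φ : CoprodI G →* CoprodI G} (hn : φ.range.Normal) (hφ : φ.range ≠ ⊥) :
    Function.Bijective φ := by
  have : Group.FG (CoprodI G) := fg
  have hfi : φ.range.FiniteIndex :=
    finiteIndex_of_normal_of_fg hφ ((Group.fg_iff_subgroup_fg _).1 inferInstance) ha hb hc hbc
  obtain ⟨C, hC⟩ := exists_index_range_le ha hb hc hbc
  obtain ⟨ψ, hψ, hψφ⟩ := Subgroup.exists_map_iterate_eq_of_index_le hfi hC
  let φ' : ψ.range →* ψ.range := (φ.comp ψ.range.subtype).codRestrict ψ.range fun x =>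
    hψφ.le ⟨x, x.2, rfl⟩
  have hφ' : Function.Surjective φ' := fun ⟨y, hy⟩ => by
    obtain ⟨x, hx, rfl⟩ := hψφ.ge hy
    exact ⟨⟨x, hx⟩, rfl⟩
  have hinj' := Group.ResiduallyFinite.injective_of_surjective hφ'
  have hdisj : Disjoint φ.ker ψ.range := by
    refine Subgroup.disjoint_def.2 fun {x} hx hxψ => ?_
    exact congrArg Subtype.val (@hinj' ⟨x, hxψ⟩ 1 (Subtype.ext (hx.trans (map_one φ).symm)))
  have hker : Finite φ.ker := Subgroup.finite_of_disjoint_finiteIndex hdisj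
  have hinj : φ.ker = ⊥ := by
    by_contra hne
    have := finiteIndex_of_normal_of_fg hne ((Group.fg_iff_subgroup_fg _).1 inferInstance)
      ha hb hc hbc
    have hinf := infinite_of_ne ha hb hc hbc
    have hcard := φ.ker.card_mul_index
    rw [Nat.card_eq_zero_of_infinite (α := CoprodI G)] at hcard
    exact mul_ne_zero Nat.card_pos.ne' this.index_ne_zero hcard
  rw [MonoidHom.ker_eq_bot_iff] at hinj
  refine ⟨hinj, MonoidHom.range_eq_top.1 ?_⟩
  have h := ψ.range.index_map_of_injective hinj
  rw [hψφ] at h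
  exact Subgroup.index_eq_one.1 ((mul_eq_left₀ hψ.index_ne_zero).1 h.symm)

end Monoid.CoprodI

universe u

/-- The family of groups indexed by `Bool` with the given two members. -/
def BoolFamily (A B : Type u) : Bool → Type u
  | false => A
  | true => B

section BoolFamily

variable (A B : Type u) [Group A] [Group B]

instance : ∀ b, Group (BoolFamily A B b)
  | false => inferInstanceAs (Group A)
  | true => inferInstanceAs (Group B)

instance [hA : Group.FG A] [hB : Group.FG B] : ∀ b, Group.FG (BoolFamily A B b)
  | false => hA
  | true => hB

instance [hA : Group.ResiduallyFinite A] [hB : Group.ResiduallyFinite B] :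
    ∀ b, Group.ResiduallyFinite (BoolFamily A B b)
  | false => hA
  | true => hB

/-- The binary free product as an indexed free product. -/
def Monoid.Coprod.equivCoprodI : Monoid.Coprod A B ≃* Monoid.CoprodI (BoolFamily A B) :=
  let f : Monoid.Coprod A B →* Monoid.CoprodI (BoolFamily A B) :=
    Coprod.lift (CoprodI.of (M := BoolFamily A B) (i := false))
      (CoprodI.of (M := BoolFamily A B) (i := true))
  let g : Monoid.CoprodI (BoolFamily A B) →* Monoid.Coprod A B := CoprodI.lift fun b => match b with
    | false => (Coprod.inl : A →* Coprod A B)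
    | true => (Coprod.inr : B →* Coprod A B)
  MonoidHom.toMulEquiv f g
    (Coprod.hom_ext (MonoidHom.ext fun x => CoprodI.lift_of ..)
      (MonoidHom.ext fun x => CoprodI.lift_of ..))
    (CoprodI.ext_hom _ _ fun b => MonoidHom.ext fun x => match b with
      | false => by
        change f (g (CoprodI.of x)) = CoprodI.of x
        rw [CoprodI.lift_of]
        exact Coprod.lift_apply_inl ..
      | true => by
        change f (g (CoprodI.of x)) = CoprodI.of x
        rw [CoprodI.lift_of]
        exact Coprod.lift_apply_inr ..)

end BoolFamily

theorem Monoid.Coprod.bijective_of_normal_range {A B : Type u} [Group A] [Group B] [Group.FG A]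
    [Group.FG B] [Group.ResiduallyFinite A] [Group.ResiduallyFinite B] {a : A} (ha : a ≠ 1)
    {b c : B} (hb : b ≠ 1) (hc : c ≠ 1) (hbc : b ≠ c) {φ : Coprod A B →* Coprod A B}
    (hn : φ.range.Normal) (hφ : φ.range ≠ ⊥) : Function.Bijective φ := by
  let e := equivCoprodI A B
  have he : e.symm.toMonoidHom.range = ⊤ := MonoidHom.range_eq_top.2 e.symm.surjective
  let φ' := (e.toMonoidHom.comp φ).comp e.symm.toMonoidHom
  have hrange : φ'.range = φ.range.map e.toMonoidHom := by
    rw [MonoidHom.range_comp, he, ← MonoidHom.range_eq_map, MonoidHom.range_comp]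
  have h := CoprodI.bijective_of_normal_range (G := BoolFamily A B) (a := a) ha (b := b) (c := c)
    hb hc hbc (φ := φ') (hrange ▸ hn.map _ e.surjective)
    (hrange ▸ mt (Subgroup.map_eq_bot_iff_of_injective _ (f := e.toMonoidHom) e.injective).1 hφ)
  have hφ' : ⇑φ = e.symm ∘ φ' ∘ e := funext fun x => by simp [φ']
  rw [hφ']
  exact e.symm.bijective.comp (h.comp e.bijective)

theorem exists_ne_one_of_not_nonempty_mulEquiv {G : Type*} [Group G] [Nontrivial G]
    (h : ¬ Nonempty (G ≃* Multiplicative (ZMod 2))) : ∃ b c : G, b ≠ 1 ∧ c ≠ 1 ∧ b ≠ c := by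
  by_contra! hG
  obtain ⟨b, hb⟩ := exists_ne (1 : G)
  have : Fact (Nat.Prime 2) := ⟨Nat.prime_two⟩
  refine h ⟨mulEquivOfPrimeCardEq (p := 2) ?_ (by simp)⟩
  refine Nat.card_eq_two_iff.2 ⟨1, b, hb.symm, Set.eq_univ_of_forall fun c => ?_⟩
  by_cases hc : c = 1
  · exact Or.inl hc
  · exact Or.inr (hG b c hb hc).symm

theorem ResiduallyFinite.group_residuallyFinite {G : Type*} [Group G] (h : ResiduallyFinite G) :
    Group.ResiduallyFinite G :=
  Group.residuallyFinite_of_forall_exists_finite_monoidHom fun g hg =>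
    let ⟨Q, hQ, hfin, f, _, hf⟩ := h g hg
    ⟨Q, hQ, hfin, f, hf⟩

theorem commutator_eq_top_of_quotient {G : Type*} [Group G] {N : Subgroup G} [hn : N.Normal]
    (hN : N = ⊥) (h : commutator (G ⧸ N) = ⊤) : commutator G = ⊤ := by
  subst hN
  have hs : (QuotientGroup.quotientBot (G := G)).toMonoidHom.range = ⊤ :=
    MonoidHom.range_eq_top.2 QuotientGroup.quotientBot.surjective
  have := congrArg (Subgroup.map (QuotientGroup.quotientBot (G := G)).toMonoidHom) h
  rwa [commutator_def, Subgroup.map_commutator, ← MonoidHom.range_eq_map, hs,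
    ← commutator_def] at this

theorem freeProduct_residuallyFinite_isPerfectlyHopfian
    (G₁ G₂ : Type) [Group G₁] [Group G₂] [Nontrivial G₁] [Nontrivial G₂]
    [Group.FG G₁] [Group.FG G₂]
    (hr₁ : ResiduallyFinite G₁) (hr₂ : ResiduallyFinite G₂)
    (hZ2 : ¬ Nonempty (G₂ ≃* Multiplicative (ZMod 2)))
    (hnp : commutator (Monoid.Coprod G₁ G₂) ≠ ⊤) :
    PerfectlyHopfian (Monoid.Coprod G₁ G₂) := by
  intro φ hn hperf
  have := hr₁.group_residuallyFinite
  have := hr₂.group_residuallyFinite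
  obtain ⟨a, ha⟩ := exists_ne (1 : G₁)
  obtain ⟨b, c, hb, hc, hbc⟩ := exists_ne_one_of_not_nonempty_mulEquiv hZ2
  exact Monoid.Coprod.bijective_of_normal_range ha hb hc hbc hn fun h =>
    hnp (commutator_eq_top_of_quotient h hperf)
end

section
/- Let G₁ and G₂ be nontrivial, finitely generated groups such that G₁ is non-cyclic and the free product G₁ ∗ G₂ is Hopfian and not perfect. Then G₁ ∗ G₂ is perfectly-Hopfian. -/
/-- A group is Hopfian if every surjective endomorphism is an automorphism. -/
def IsHopfianGroup (G : Type*) [Group G] : Prop :=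
  ∀ φ : G →* G, Function.Surjective φ → Function.Bijective φ

/-! ### Groupoids generated by labelled arrows -/

section Arrows

variable {Ω A : Type*} [Group A]

/-- The groupoid on the objects `Ω`, with arrows labelled in `A`, generated by a list of arrows
`(source, label, target)`. -/
inductive ArrowGen (E : List (Ω × A × Ω)) : Ω → A → Ω → Prop
  | refl (u : Ω) : ArrowGen E u 1 u
  | basic {u v : Ω} {a : A} : (u, a, v) ∈ E → ArrowGen E u a v
  | symm {u v : Ω} {a : A} : ArrowGen E u a v → ArrowGen E v a⁻¹ u
  | trans {u v w : Ω} {a b : A} : ArrowGen E u a v → ArrowGen E v b w → ArrowGen E u (a * b) w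

namespace ArrowGen

variable {E E' : List (Ω × A × Ω)}

theorem of_forall_mem (h : ∀ e ∈ E, ArrowGen E' e.1 e.2.1 e.2.2) {u v : Ω} {a : A}
    (hg : ArrowGen E u a v) : ArrowGen E' u a v := by
  induction hg with
  | refl u => exact refl u
  | basic hm => exact h _ hm
  | symm _ ih => exact ih.symm
  | trans _ _ ih ih' => exact ih.trans ih'

theorem mono (h : E ⊆ E') {u v : Ω} {a : A} (hg : ArrowGen E u a v) : ArrowGen E' u a v :=
  hg.of_forall_mem fun _ he => basic (h he)

/-- A potential compatible with the generating arrows is compatible with all arrows. -/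
theorem potential {Q : Type*} [Group Q] {f : A →* Q} {q : Ω → Q}
    (h : ∀ e ∈ E, q e.1 * f e.2.1 = q e.2.2) {u v : Ω} {a : A} (hg : ArrowGen E u a v) :
    q u * f a = q v := by
  induction hg with
  | refl u => simp
  | basic hm => exact h _ hm
  | symm _ ih => rw [← ih]; simp
  | trans _ _ ih ih' => rw [← ih', ← ih, map_mul, mul_assoc]

theorem eq_or_mem {V : Set Ω} (h : ∀ e ∈ E, e.1 ∈ V ∧ e.2.2 ∈ V) {u v : Ω} {a : A}
    (hg : ArrowGen E u a v) : u = v ∨ u ∈ V ∧ v ∈ V := by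
  induction hg with
  | refl u => exact .inl rfl
  | basic hm => exact .inr (h _ hm)
  | symm _ ih => grind
  | trans _ _ ih ih' => grind

theorem exists_mem_ne {v : Ω} {x y : Ω} {a : A} (hg : ArrowGen E x a y)
    (h : ¬(x = v ↔ y = v)) : ∃ e ∈ E, ¬(e.1 = v ↔ e.2.2 = v) := by
  induction hg with
  | refl u => simp at h
  | basic hm => exact ⟨_, hm, h⟩
  | symm _ ih => exact ih (by tauto)
  | trans _ _ ih ih' =>
    by_contra hc
    exact h ((not_not.1 fun h₁ => hc (ih h₁)).trans (not_not.1 fun h₁ => hc (ih' h₁)))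

open Classical in
/-- A non-isolated object can be removed at the cost of one generating arrow. -/
theorem exists_delete {v w : Ω} {b : A} (hvw : w ≠ v) (hg : ArrowGen E v b w) :
    ∃ E' : List (Ω × A × Ω), E'.length + 1 = E.length ∧
      (∀ e ∈ E', e.1 ≠ v ∧ e.2.2 ≠ v) ∧
      (∀ V : Set Ω, (∀ e ∈ E, e.1 ∈ V ∧ e.2.2 ∈ V) → ∀ e ∈ E', e.1 ∈ V ∧ e.2.2 ∈ V) ∧
      ∀ x a y, x ≠ v → y ≠ v → (ArrowGen E' x a y ↔ ArrowGen E x a y) := by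
  obtain ⟨f, hf, hfv⟩ := hg.exists_mem_ne (v := v) (by simpa using hvw)
  obtain ⟨t, c, htv, hgen, htV, hone⟩ : ∃ t c, t ≠ v ∧ ArrowGen E v c t ∧
      (∀ V : Set Ω, (∀ e ∈ E, e.1 ∈ V ∧ e.2.2 ∈ V) → t ∈ V) ∧
      (f = (v, c, t) ∨ f = (t, c⁻¹, v)) := by
    obtain ⟨p, c, s⟩ := f
    by_cases hp : p = v
    · subst hp
      exact ⟨s, c, by simpa using hfv, basic hf, fun V hV => (hV _ hf).2, .inl rfl⟩
    · obtain rfl : s = v := by simp only [hp, false_iff, not_not] at hfv; exact hfv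
      exact ⟨p, c⁻¹, hp, (basic hf).symm, fun V hV => (hV _ hf).1, .inr (by simp)⟩
  let τ : Ω → A := fun x => if x = v then c else 1
  let ρ : Ω → Ω := fun x => if x = v then t else x
  have hρ : ∀ x, ρ x ≠ v := fun x => by by_cases hx : x = v <;> simp [ρ, hx, htv]
  have hτ : ∀ x, ArrowGen E x (τ x) (ρ x) := fun x => by
    by_cases hx : x = v
    · simpa [τ, ρ, hx] using hgen
    · simpa [τ, ρ, hx] using refl x
  let sh : Ω × A × Ω → Ω × A × Ω := fun e => (ρ e.1, (τ e.1)⁻¹ * e.2.1 * τ e.2.2, ρ e.2.2)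
  have hto : ∀ {x a y}, ArrowGen E x a y →
      ArrowGen ((E.erase f).map sh) (ρ x) ((τ x)⁻¹ * a * τ y) (ρ y) := by
    intro x a y h
    induction h with
    | refl u => simpa using refl _
    | @basic u w a hm =>
      by_cases hef : (u, a, w) = f
      · rcases hone with h1 | h1 <;> rw [← hef] at h1 <;>
          obtain ⟨rfl, rfl, rfl⟩ : u = _ ∧ a = _ ∧ w = _ := by simpa using h1
        · simpa [ρ, τ, htv] using refl _
        · simpa [ρ, τ, htv] using refl _
      · exact basic (List.mem_map.2 ⟨_, (List.mem_erase_of_ne hef).2 hm, rfl⟩)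
    | symm _ ih => simpa [mul_assoc] using ih.symm
    | trans _ _ ih ih' => simpa [mul_assoc] using ih.trans ih'
  refine ⟨(E.erase f).map sh, ?_, ?_, ?_, ?_⟩
  · rw [List.length_map, List.length_erase_of_mem hf]
    have := List.length_pos_of_mem hf
    omega
  · simp only [List.mem_map]
    rintro _ ⟨e, -, rfl⟩
    exact ⟨hρ _, hρ _⟩
  · simp only [List.mem_map]
    rintro V hV _ ⟨e, he, rfl⟩
    have hρV : ∀ x ∈ V, ρ x ∈ V := fun x hx => by
      by_cases hxv : x = v
      · simpa [ρ, hxv] using htV V hV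
      · simpa [ρ, hxv] using hx
    have := hV e (List.mem_of_mem_erase he)
    exact ⟨hρV _ this.1, hρV _ this.2⟩
  · intro x a y hx hy
    constructor
    · refine of_forall_mem ?_
      simp only [List.mem_map]
      rintro _ ⟨e, he, rfl⟩
      exact ((hτ _).symm.trans (basic (List.mem_of_mem_erase he))).trans (hτ _)
    · intro h
      simpa [ρ, τ, hx, hy] using hto h

theorem exists_delete_finset [DecidableEq Ω] (S : Finset Ω) :
    ∀ E : List (Ω × A × Ω), (∀ s ∈ S, ∃ t ∉ S, ∃ a, ArrowGen E s a t) →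
    ∃ E' : List (Ω × A × Ω), E'.length + S.card = E.length ∧
      (∀ e ∈ E', e.1 ∉ S ∧ e.2.2 ∉ S) ∧
      (∀ V : Set Ω, (∀ e ∈ E, e.1 ∈ V ∧ e.2.2 ∈ V) → ∀ e ∈ E', e.1 ∈ V ∧ e.2.2 ∈ V) ∧
      ∀ x a y, x ∉ S → y ∉ S → (ArrowGen E' x a y ↔ ArrowGen E x a y) := by
  induction S using Finset.induction_on with
  | empty => exact fun E _ => ⟨E, by simp⟩
  | insert s S hs ih =>
    intro E h
    obtain ⟨t, ht, a, hsta⟩ := h s (Finset.mem_insert_self _ _)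
    obtain ⟨E₁, hl₁, hv₁, hV₁, hg₁⟩ := exists_delete (by grind) hsta
    obtain ⟨E₂, hl₂, hv₂, hV₂, hg₂⟩ := ih E₁ fun x hx => by
      obtain ⟨y, hy, b, hxy⟩ := h x (Finset.mem_insert_of_mem hx)
      exact ⟨y, by grind, b, (hg₁ x b y (by grind) (by grind)).2 hxy⟩
    refine ⟨E₂, ?_, ?_, fun V hV => hV₂ V (hV₁ V hV), fun x a y hx hy => ?_⟩
    · rw [Finset.card_insert_of_notMem hs]; omega
    · intro e he
      have h1 := hV₂ {x | x ≠ s} hv₁ e he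
      have h2 := hv₂ e he
      simp only [Set.mem_ofPred_eq] at h1
      grind
    · rw [hg₂ x a y (by grind) (by grind), hg₁ x a y (by grind) (by grind)]

/-- A lower bound for the number of arrows generating the action groupoid of `A` on a finite
group `Q` through `f : A →* Q`, in terms of the number of generators of `f.ker`. -/
theorem exists_closure_eq_ker {Q : Type*} [Group Q] [Finite Q] (f : A →* Q) {s : Q → Ω}
    (hs : Function.Injective s) (hE : ∀ e ∈ E, e.1 ∈ Set.range s ∧ e.2.2 ∈ Set.range s)
    (hg : ∀ g a g', ArrowGen E (s g) a (s g') ↔ g * f a = g') :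
    ∃ S : Finset A, Subgroup.closure (S : Set A) = f.ker ∧
      f.range.index * S.card + Nat.card Q ≤ E.length + f.range.index := by
  classical
  have := Fintype.ofFinite Q
  have := Fintype.ofFinite (Q ⧸ f.range)
  let r : Q ⧸ f.range → Ω := fun c => s c.out
  have hr : Function.Injective r := fun c d h => by
    have := hs h
    rw [← c.out_eq', this, Quotient.out_eq']
  let T : Finset Ω := Finset.univ.image r
  let V : Finset Ω := Finset.univ.image s
  have hTc : T.card = f.range.index := by
    rw [Finset.card_image_of_injective _ hr, Finset.card_univ, Subgroup.index,
      Nat.card_eq_fintype_card]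
  have hVc : V.card = Nat.card Q := by
    rw [Finset.card_image_of_injective _ hs, Finset.card_univ, Nat.card_eq_fintype_card]
  have hTV : T ⊆ V := by
    intro x hx
    obtain ⟨c, -, rfl⟩ := Finset.mem_image.1 hx
    exact Finset.mem_image_of_mem _ (Finset.mem_univ _)
  obtain ⟨E', hl, hv, hV, hg'⟩ := exists_delete_finset (V \ T) E (by
    intro x hx
    obtain ⟨g, -, rfl⟩ := Finset.mem_image.1 (Finset.mem_sdiff.1 hx).1
    obtain ⟨a, ha⟩ : g⁻¹ * (g : Q ⧸ f.range).out ∈ f.range :=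
      QuotientGroup.eq.1 (Quotient.out_eq' _).symm
    refine ⟨r g, ?_, a, (hg _ _ _).2 (by rw [ha]; simp)⟩
    have : r g ∈ T := Finset.mem_image_of_mem _ (Finset.mem_univ _)
    simp [this])
  have hmem : ∀ e ∈ E', e.1 ∈ T ∧ e.2.2 ∈ T := fun e he => by
    have h1 := hV (V : Set Ω) (fun e he => by simpa [V] using hE e he) e he
    have h2 := hv e he
    simp only [Finset.mem_coe, Finset.mem_sdiff] at h1 h2
    tauto
  have hnT : ∀ t ∈ T, t ∉ V \ T := fun t ht h => (Finset.mem_sdiff.1 h).2 ht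
  have hloop : ∀ e ∈ E', e.1 = e.2.2 := fun e he => by
    have hgen : ArrowGen E e.1 e.2.1 e.2.2 :=
      (hg' _ _ _ (hv e he).1 (hv e he).2).1 (basic he)
    obtain ⟨h1, h2⟩ := hmem e he
    obtain ⟨c, -, hc⟩ := Finset.mem_image.1 h1
    obtain ⟨d, -, hd⟩ := Finset.mem_image.1 h2
    rw [← hc, ← hd] at hgen ⊢
    have h3 := (hg _ _ _).1 hgen
    have : c = d := by
      rw [← c.out_eq', ← d.out_eq']
      exact QuotientGroup.eq.2 ⟨e.2.1, by rw [← h3]; simp⟩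
    rw [this]
  let S : Ω → Finset A := fun t => ((E'.filter fun e => e.1 = t).map fun e => e.2.1).toFinset
  have hScard : ∀ t, (S t).card ≤ (E'.map Prod.fst).count t := fun t => by
    refine (List.toFinset_card_le _).trans ?_
    rw [List.length_map, List.count, List.countP_map, List.countP_eq_length_filter]
    refine le_of_eq (congrArg List.length (List.filter_congr fun e _ => ?_))
    simp [beq_eq_decide]
  have hsum : ∑ t ∈ T, (E'.map Prod.fst).count t = E'.length := by
    have := Multiset.sum_count_eq_card (s := T) (m := ((E'.map Prod.fst : List Ω) : Multiset Ω))
      (by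
        intro x hx
        obtain ⟨e, he, rfl⟩ := List.mem_map.1 (Multiset.mem_coe.1 hx)
        exact (hmem e he).1)
    simpa using this
  obtain ⟨t, ht, hmin⟩ := T.exists_min_image (fun t => (S t).card)
    ⟨r (1 : Q), Finset.mem_image_of_mem _ (Finset.mem_univ _)⟩
  have hker : ∀ a, ArrowGen E' t a t ↔ a ∈ f.ker := fun a => by
    rw [hg' _ _ _ (hnT t ht) (hnT t ht)]
    obtain ⟨c, -, rfl⟩ := Finset.mem_image.1 ht
    rw [hg, MonoidHom.mem_ker, mul_eq_left]
  refine ⟨S t, le_antisymm ?_ ?_, ?_⟩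
  · rw [Subgroup.closure_le]
    intro a ha
    simp only [S, Finset.mem_coe, List.mem_toFinset, List.mem_map, List.mem_filter,
      decide_eq_true_eq] at ha
    obtain ⟨e, ⟨he, rfl⟩, rfl⟩ := ha
    refine (hker _).1 ?_
    have := basic (E := E') (u := e.1) (a := e.2.1) (v := e.2.2) he
    rwa [← hloop e he] at this
  · intro a ha
    have key : ∀ {x a y}, ArrowGen E' x a y →
        x = y ∧ (x = t → a ∈ Subgroup.closure (S t : Set A)) := by
      intro x a y h
      induction h with
      | refl u => exact ⟨rfl, fun _ => one_mem _⟩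
      | @basic u v a hm =>
        refine ⟨hloop _ hm, fun hu => Subgroup.subset_closure ?_⟩
        simp only [S, Finset.mem_coe, List.mem_toFinset, List.mem_map, List.mem_filter,
          decide_eq_true_eq]
        exact ⟨_, ⟨hm, hu⟩, rfl⟩
      | symm _ ih => exact ⟨ih.1.symm, fun h => inv_mem (ih.2 (ih.1.trans h))⟩
      | trans _ _ ih ih' =>
        exact ⟨ih.1.trans ih'.1, fun h => mul_mem (ih.2 h) (ih'.2 (ih.1 ▸ h))⟩
    exact (key ((hker a).2 ha)).2 rfl
  · have h1 : T.card * (S t).card ≤ E'.length := by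
      rw [← hsum, ← smul_eq_mul]
      exact Finset.card_nsmul_le_sum _ _ _ fun x hx => (hmin x hx).trans (hScard x)
    rw [Finset.card_sdiff_of_subset hTV] at hl
    have h2 := Finset.card_le_card hTV
    rw [← hTc, ← hVc]
    omega

end ArrowGen

end Arrows

/-! ### Folding labelled graphs over a free product of two groups -/

section Folding

open Monoid

variable {M : Bool → Type*} [∀ i, Group (M i)]

/-- Paths through the arrows generated by `E true` and `E false`, labelled in the free product. -/
inductive ArrowPath (E : ∀ i, List (ℕ × M i × ℕ)) : ℕ → CoprodI M → ℕ → Prop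
  | refl (u : ℕ) : ArrowPath E u 1 u
  | cons {i : Bool} {u v w : ℕ} {a : M i} {x : CoprodI M} :
      ArrowGen (E i) u a v → ArrowPath E v x w → ArrowPath E u (CoprodI.of a * x) w

namespace ArrowPath

variable {E E' : ∀ i, List (ℕ × M i × ℕ)}

theorem single {i : Bool} {u v : ℕ} {a : M i} (h : ArrowGen (E i) u a v) :
    ArrowPath E u (CoprodI.of a) v := by
  simpa using cons h (refl v)

theorem trans {u v w : ℕ} {x y : CoprodI M} (h : ArrowPath E u x v) (h' : ArrowPath E v y w) :
    ArrowPath E u (x * y) w := by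
  induction h with
  | refl u => simpa using h'
  | cons ha _ ih => rw [mul_assoc]; exact cons ha (ih h')

theorem symm {u v : ℕ} {x : CoprodI M} (h : ArrowPath E u x v) : ArrowPath E v x⁻¹ u := by
  induction h with
  | refl u => simpa using refl u
  | cons ha _ ih =>
    rw [mul_inv_rev, ← map_inv]
    exact ih.trans (single ha.symm)

theorem map {ρ : ℕ → ℕ} (h : ∀ i u a v, ArrowGen (E i) u a v → ArrowGen (E' i) (ρ u) a (ρ v))
    {u v : ℕ} {x : CoprodI M} (hp : ArrowPath E u x v) : ArrowPath E' (ρ u) x (ρ v) := by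
  induction hp with
  | refl u => exact refl _
  | cons ha _ ih => exact cons (h _ _ _ _ ha) ih

theorem mono (h : ∀ i, E i ⊆ E' i) {u v : ℕ} {x : CoprodI M} (hp : ArrowPath E u x v) :
    ArrowPath E' u x v :=
  hp.map (ρ := id) fun i _ _ _ hg => hg.mono (h i)

end ArrowPath

variable {Q : Type*} [Group Q]

/-- A connected graph with vertex set `V` and base point `0`, whose arrows are compatible with a
potential `q` with values in a quotient `Q` of the free product. -/
structure IsLabelledGraph (f : CoprodI M →* Q) (E : ∀ i, List (ℕ × M i × ℕ)) (V : Finset ℕ)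
    (q : ℕ → Q) : Prop where
  base : 0 ∈ V
  inside : ∀ i, ∀ e ∈ E i, e.1 ∈ V ∧ e.2.2 ∈ V
  compat : ∀ i, ∀ e ∈ E i, q e.1 * f (CoprodI.of e.2.1) = q e.2.2
  base_eq : q 0 = 1
  conn : ∀ v ∈ V, ∃ x, ArrowPath E 0 x v

namespace IsLabelledGraph

variable {f : CoprodI M →* Q} {E : ∀ i, List (ℕ × M i × ℕ)} {V : Finset ℕ} {q : ℕ → Q}

theorem gen_compat (h : IsLabelledGraph f E V q) {i : Bool} {u v : ℕ} {a : M i}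
    (hg : ArrowGen (E i) u a v) : q u * f (CoprodI.of a) = q v :=
  ArrowGen.potential (f := f.comp CoprodI.of) (h.compat i) hg

theorem path_compat (h : IsLabelledGraph f E V q) {u v : ℕ} {x : CoprodI M}
    (hp : ArrowPath E u x v) : q u * f x = q v := by
  induction hp with
  | refl u => simp
  | cons ha _ ih => rw [map_mul, ← mul_assoc, h.gen_compat ha, ih]

theorem path_mem (h : IsLabelledGraph f E V q) {u v : ℕ} {x : CoprodI M}
    (hp : ArrowPath E u x v) (hu : u ∈ V) : v ∈ V := by
  induction hp with
  | refl u => exact hu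
  | cons ha _ ih =>
    refine ih ?_
    rcases ArrowGen.eq_or_mem (V := (V : Set ℕ)) (h.inside _) ha with rfl | h'
    · exact hu
    · exact h'.2

theorem exists_add_arrow (h : IsLabelledGraph f E V q) {i : Bool} {u v : ℕ} {a : M i}
    (hu : u ∈ V) (hv : v ∈ V) (hq : q u * f (CoprodI.of a) = q v) :
    ∃ E', IsLabelledGraph f E' V q ∧ (∀ i, E i ⊆ E' i) ∧ (u, a, v) ∈ E' i ∧
      (E' true).length + (E' false).length = (E true).length + (E false).length + 1 := by
  have hsub : ∀ j, E j ⊆ Function.update E i ((u, a, v) :: E i) j := fun j => by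
    by_cases hj : j = i
    · subst hj; simp
    · simp [hj]
  refine ⟨Function.update E i ((u, a, v) :: E i), ⟨h.base, fun j e he => ?_, fun j e he => ?_,
    h.base_eq, fun w hw => ?_⟩, hsub, by simp, ?_⟩
  · by_cases hj : j = i
    · subst hj
      rw [Function.update_self, List.mem_cons] at he
      rcases he with rfl | he
      · exact ⟨hu, hv⟩
      · exact h.inside _ _ he
    · rw [Function.update_of_ne hj] at he
      exact h.inside _ _ he
  · by_cases hj : j = i
    · subst hj
      rw [Function.update_self, List.mem_cons] at he
      rcases he with rfl | he
      · exact hq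
      · exact h.compat _ _ he
    · rw [Function.update_of_ne hj] at he
      exact h.compat _ _ he
  · obtain ⟨x, hx⟩ := h.conn w hw
    exact ⟨x, hx.mono hsub⟩
  · cases i <;> simp <;> omega

/-- A word can be read along a path of fresh vertices. -/
theorem exists_add_path (x : CoprodI M) : ∀ {E : ∀ i, List (ℕ × M i × ℕ)} {V : Finset ℕ}
    {q : ℕ → Q}, IsLabelledGraph f E V q → ∀ u ∈ V, ∃ E' V' q', IsLabelledGraph f E' V' q' ∧
      (∀ i, E i ⊆ E' i) ∧ (∃ v ∈ V', ArrowPath E' u x v) ∧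
      (E' true).length + (E' false).length + V.card
        = (E true).length + (E false).length + V'.card := by
  induction x using CoprodI.induction_left with
  | one => exact fun {E V q} h u hu =>
      ⟨E, V, q, h, fun _ => List.Subset.refl _, ⟨u, hu, .refl u⟩, rfl⟩
  | @mul i a x ih =>
    intro E V q h u hu
    obtain ⟨v, hv⟩ := Infinite.exists_notMem_finset V
    let E₁ := Function.update E i ((u, a, v) :: E i)
    let q₁ := Function.update q v (q u * f (CoprodI.of a))
    have hq₁ : ∀ w ∈ V, q₁ w = q w := fun w hw =>
      Function.update_of_ne (by rintro rfl; exact hv hw) _ _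
    have hsub : ∀ j, E j ⊆ E₁ j := fun j => by
      by_cases hj : j = i
      · subst hj; simp [E₁]
      · simp [E₁, hj]
    have hmem : ∀ j, ∀ e ∈ E₁ j, e ∈ E j ∨
        (e.1 = u ∧ e.2.2 = v ∧ q₁ e.1 * f (CoprodI.of e.2.1) = q₁ e.2.2) := by
      intro j e he
      by_cases hj : j = i
      · subst hj
        simp only [E₁, Function.update_self, List.mem_cons] at he
        rcases he with rfl | he
        · refine .inr ⟨rfl, rfl, ?_⟩
          simp only [hq₁ u hu]
          simp [q₁]
        · exact .inl he
      · simp only [E₁, Function.update_of_ne hj] at he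
        exact .inl he
    have huv : ArrowGen (E₁ i) u a v := .basic (by simp [E₁])
    have h₁ : IsLabelledGraph f E₁ (insert v V) q₁ := by
      refine ⟨Finset.mem_insert_of_mem h.base, fun j e he => ?_, fun j e he => ?_,
        by rw [hq₁ 0 h.base, h.base_eq], fun w hw => ?_⟩
      · rcases hmem j e he with he | ⟨h1, h2, -⟩
        · have := h.inside _ _ he
          exact ⟨Finset.mem_insert_of_mem this.1, Finset.mem_insert_of_mem this.2⟩
        · rw [h1, h2]
          exact ⟨Finset.mem_insert_of_mem hu, Finset.mem_insert_self _ _⟩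
      · rcases hmem j e he with he | ⟨-, -, h3⟩
        · have := h.inside _ _ he
          rw [hq₁ _ this.1, hq₁ _ this.2, h.compat _ _ he]
        · exact h3
      · rcases Finset.mem_insert.1 hw with rfl | hw
        · obtain ⟨y, hy⟩ := h.conn u hu
          exact ⟨_, (hy.mono hsub).trans (.single huv)⟩
        · obtain ⟨y, hy⟩ := h.conn w hw
          exact ⟨y, hy.mono hsub⟩
    obtain ⟨E', V', q', h', hsub', ⟨w, hw, hp⟩, hc⟩ := ih h₁ v (Finset.mem_insert_self _ _)
    refine ⟨E', V', q', h', fun j => List.Subset.trans (hsub j) (hsub' j),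
      ⟨w, hw, .cons (huv.mono (hsub' i)) hp⟩, ?_⟩
    have hl : (E₁ true).length + (E₁ false).length
        = (E true).length + (E false).length + 1 := by
      cases i <;> simp [E₁] <;> omega
    rw [Finset.card_insert_of_notMem hv] at hc
    omega

theorem exists_add_loop (h : IsLabelledGraph f E V q) {y : CoprodI M} (hy : f y = 1) :
    ∃ E' V' q', IsLabelledGraph f E' V' q' ∧ (∀ i, E i ⊆ E' i) ∧ ArrowPath E' 0 y 0 ∧
      (E' true).length + (E' false).length + V.card
        = (E true).length + (E false).length + V'.card + 1 := by
  obtain ⟨E₁, V₁, q₁, h₁, hsub₁, ⟨v, hv, hp⟩, hc₁⟩ := exists_add_path y h 0 h.base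
  obtain ⟨E₂, h₂, hsub₂, hm, hc₂⟩ := h₁.exists_add_arrow (i := true) (a := 1) hv h₁.base
    (by rw [← h₁.path_compat hp, h₁.base_eq, hy]; simp)
  refine ⟨E₂, V₁, q₁, h₂, fun j => List.Subset.trans (hsub₁ j) (hsub₂ j), ?_, by omega⟩
  simpa using (hp.mono hsub₂).trans (.single (.basic hm))

theorem exists_of_list (f : CoprodI M →* Q) (l : List (CoprodI M)) (hl : ∀ y ∈ l, f y = 1) :
    ∃ E V q, IsLabelledGraph f E V q ∧ (∀ y ∈ l, ArrowPath E 0 y 0) ∧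
      (E true).length + (E false).length + 1 = V.card + l.length := by
  induction l with
  | nil =>
    exact ⟨fun _ => [], {0}, fun _ => 1, ⟨by simp, by simp, by simp, rfl, fun v hv =>
      ⟨1, by obtain rfl : v = 0 := by simpa using hv
             exact .refl _⟩⟩, by simp, by simp⟩
  | cons y l ih =>
    obtain ⟨E, V, q, h, hp, hc⟩ := ih fun z hz => hl z (List.mem_cons_of_mem _ hz)
    obtain ⟨E', V', q', h', hsub, hy, hc'⟩ := h.exists_add_loop (hl y List.mem_cons_self)
    refine ⟨E', V', q', h', fun z hz => ?_, by rw [List.length_cons]; omega⟩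
    rcases List.mem_cons.1 hz with rfl | hz
    · exact hy
    · exact (hp z hz).mono hsub

/-- Two vertices joined by an arrow with trivial label can be identified. -/
theorem exists_fold (h : IsLabelledGraph f E V q) {i : Bool} {u v : ℕ} (hu : u ∈ V) (hv : v ∈ V)
    (huv : u ≠ v) (hv0 : v ≠ 0) (hg : ArrowGen (E i) u 1 v) :
    ∃ E' V', IsLabelledGraph f E' V' q ∧ V'.card < V.card ∧
      (∀ x, ArrowPath E 0 x 0 → ArrowPath E' 0 x 0) ∧
      (E' true).length + (E' false).length + V.card
        = (E true).length + (E false).length + V'.card := by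
  obtain ⟨E₁, h₁, hsub, hm, hc⟩ := h.exists_add_arrow (i := !i) (a := 1) hu hv
    (by simpa using h.gen_compat hg)
  have hg₁ : ∀ j, ArrowGen (E₁ j) u 1 v := fun j => by
    by_cases hj : j = i
    · subst hj; exact hg.mono (hsub j)
    · obtain rfl : j = !i := by cases i <;> cases j <;> simp_all
      exact .basic hm
  choose E₂ hl hE₂ hV hgen using fun j =>
    ArrowGen.exists_delete huv (by simpa using (hg₁ j).symm : ArrowGen (E₁ j) v 1 u)
  let ρ : ℕ → ℕ := fun x => if x = v then u else x
  have hρ : ∀ x, x ≠ v → ρ x = x := fun x hx => by simp [ρ, hx]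
  have hρv : ∀ x, ρ x ≠ v := fun x => by by_cases hx : x = v <;> simp [ρ, hx, huv]
  have hpath : ∀ {x p y}, ArrowPath E x p y → ArrowPath E₂ (ρ x) p (ρ y) := by
    refine fun hp => hp.map (ρ := ρ) fun j x a y hxy => (hgen j _ _ _ (hρv _) (hρv _)).2 ?_
    have hto : ∀ x, ArrowGen (E₁ j) (ρ x) 1 x := fun x => by
      by_cases hx : x = v
      · simpa [ρ, hx] using hg₁ j
      · simpa [ρ, hx] using ArrowGen.refl x
    simpa using ((hto x).trans (hxy.mono (hsub j))).trans (hto y).symm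
  refine ⟨E₂, V.erase v, ⟨?_, fun j e he => ?_, fun j e he => ?_, h.base_eq, fun w hw => ?_⟩,
    Finset.card_erase_lt_of_mem hv, fun x hx => ?_, ?_⟩
  · exact Finset.mem_erase.2 ⟨hv0.symm, h.base⟩
  · have h1 := hE₂ j e he
    have h2 := hV j (V : Set ℕ) (h₁.inside j) e he
    exact ⟨Finset.mem_erase.2 ⟨h1.1, h2.1⟩, Finset.mem_erase.2 ⟨h1.2, h2.2⟩⟩
  · have h1 := hE₂ j e he
    exact h₁.gen_compat ((hgen j _ _ _ h1.1 h1.2).1 (.basic he))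
  · obtain ⟨x, hx⟩ := h.conn w (Finset.mem_of_mem_erase hw)
    have := hpath hx
    rw [hρ 0 hv0.symm, hρ w (Finset.ne_of_mem_erase hw)] at this
    exact ⟨x, this⟩
  · have := hpath hx
    rwa [hρ 0 hv0.symm] at this
  · have h1 := hl true
    have h2 := hl false
    have h3 := Finset.card_erase_add_one hv
    omega

/-- A labelled graph can be folded until arrows with trivial label are trivial. -/
theorem exists_folded (n : ℕ) : ∀ {E : ∀ i, List (ℕ × M i × ℕ)} {V : Finset ℕ},
    IsLabelledGraph f E V q → V.card ≤ n → ∃ E' V', IsLabelledGraph f E' V' q ∧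
      (∀ i u v, ArrowGen (E' i) u 1 v → u = v) ∧
      (∀ x, ArrowPath E 0 x 0 → ArrowPath E' 0 x 0) ∧
      (E' true).length + (E' false).length + V.card
        = (E true).length + (E false).length + V'.card := by
  induction n with
  | zero => exact fun {E V} h hn =>
      absurd h.base (by simp [Finset.card_eq_zero.1 (Nat.le_zero.1 hn)])
  | succ n ih =>
    intro E V h hn
    by_cases hf : ∀ i u v, ArrowGen (E i) u 1 v → u = v
    · exact ⟨E, V, h, hf, fun _ hx => hx, rfl⟩
    · push Not at hf
      obtain ⟨i, u, v, hg, huv⟩ := hf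
      obtain ⟨hu, hv⟩ : u ∈ V ∧ v ∈ V :=
        (ArrowGen.eq_or_mem (V := (V : Set ℕ)) (h.inside i) hg).resolve_left huv
      obtain ⟨E₁, V₁, h₁, hlt, hp₁, hc₁⟩ : ∃ E' V', IsLabelledGraph f E' V' q ∧
          V'.card < V.card ∧ (∀ x, ArrowPath E 0 x 0 → ArrowPath E' 0 x 0) ∧
          (E' true).length + (E' false).length + V.card
            = (E true).length + (E false).length + V'.card := by
        by_cases hv0 : v = 0
        · exact h.exists_fold hv hu huv.symm (fun h0 => huv (h0.trans hv0.symm))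
            (by simpa using hg.symm)
        · exact h.exists_fold hu hv huv hv0 hg
      obtain ⟨E₂, V₂, h₂, hf₂, hp₂, hc₂⟩ := ih h₁ (by omega)
      exact ⟨E₂, V₂, h₂, hf₂, fun x hx => hp₂ x (hp₁ x hx), by omega⟩

end IsLabelledGraph

/-- `ReadsList E u l v` says that the letters of `l` can be read along arrows from `u` to `v`. -/
def ReadsList (E : ∀ i, List (ℕ × M i × ℕ)) : ℕ → List (Σ i, M i) → ℕ → Prop
  | u, [], v => u = v
  | u, x :: l, v => ∃ w, ArrowGen (E x.1) u x.2 w ∧ ReadsList E w l v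

namespace ReadsList

variable {E : ∀ i, List (ℕ × M i × ℕ)}

theorem exists_of_append {l l' : List (Σ i, M i)} : ∀ {u v : ℕ}, ReadsList E u (l ++ l') v →
    ∃ w, ReadsList E u l w := by
  induction l with
  | nil => exact fun {u v} _ => ⟨u, rfl⟩
  | cons x l ih =>
    rintro u v ⟨w, hw, h⟩
    obtain ⟨z, hz⟩ := ih h
    exact ⟨z, w, hw, hz⟩

theorem path {l : List (Σ i, M i)} : ∀ {u v : ℕ}, ReadsList E u l v →
    ArrowPath E u (l.map fun x => CoprodI.of x.2).prod v := by
  induction l with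
  | nil => rintro u v rfl; exact .refl _
  | cons x l ih =>
    rintro u v ⟨w, hw, h⟩
    simpa using ArrowPath.cons hw (ih h)

open Classical in
theorem smul (hf : ∀ i u v, ArrowGen (E i) u 1 v → u = v) {i : Bool} {u v z : ℕ} {a : M i}
    {w : CoprodI.Word M} (ha : ArrowGen (E i) u a v) (h : ReadsList E v w.toList z) :
    ReadsList E u (CoprodI.of a • w).toList z := by
  have hrcons : ∀ p : CoprodI.Word.Pair M i, ReadsList E v (CoprodI.Word.rcons p).toList z →
      ∃ t, ArrowGen (E i) v p.head t ∧ ReadsList E t p.tail.toList z := by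
    intro p hp
    by_cases h1 : p.head = 1
    · rw [CoprodI.Word.rcons, dif_pos h1] at hp
      exact ⟨v, by rw [h1]; exact .refl v, hp⟩
    · rw [CoprodI.Word.rcons, dif_neg h1] at hp
      exact hp
  have hw : CoprodI.Word.rcons (CoprodI.Word.equivPair i w) = w := by
    rw [← CoprodI.Word.equivPair_symm, Equiv.symm_apply_apply]
  obtain ⟨t, ht, htz⟩ := hrcons (CoprodI.Word.equivPair i w) (by rwa [hw])
  have hat := ha.trans ht
  rw [CoprodI.Word.of_smul_def, CoprodI.Word.rcons]
  split_ifs with h1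
  · simp only at h1
    rw [h1] at hat
    rw [hf i u t hat]
    exact htz
  · exact ⟨t, hat, htz⟩

end ReadsList

namespace ArrowPath

variable {E : ∀ i, List (ℕ × M i × ℕ)}

open Classical in
theorem readsList (hf : ∀ i u v, ArrowGen (E i) u 1 v → u = v) {u v : ℕ} {x : CoprodI M}
    (hp : ArrowPath E u x v) : ReadsList E u (CoprodI.Word.equiv x).toList v := by
  change ReadsList E u (x • (CoprodI.Word.empty : CoprodI.Word M)).toList v
  induction hp with
  | refl u => rw [one_smul]; exact rfl
  | cons ha _ ih => rw [mul_smul]; exact ih.smul hf ha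

theorem readsList_neWord (hf : ∀ i u v, ArrowGen (E i) u 1 v → u = v) {u v : ℕ} {i j : Bool}
    {w : CoprodI.NeWord M i j} (hp : ArrowPath E u w.prod v) : ReadsList E u w.toList v := by
  classical
  have h := hp.readsList hf
  have hw : CoprodI.Word.equiv w.prod = w.toWord := CoprodI.Word.equiv.apply_symm_apply _
  rwa [hw] at h

theorem eq_of_one (hf : ∀ i u v, ArrowGen (E i) u 1 v → u = v) {u v : ℕ}
    (hp : ArrowPath E u 1 v) : u = v := by
  classical
  have h := hp.readsList hf
  have hw : CoprodI.Word.equiv (1 : CoprodI M) = CoprodI.Word.empty :=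
    one_smul (CoprodI M) (CoprodI.Word.empty : CoprodI.Word M)
  rwa [hw] at h

theorem gen_of_of (hf : ∀ i u v, ArrowGen (E i) u 1 v → u = v) {u v : ℕ} {i : Bool} {a : M i}
    (hp : ArrowPath E u (CoprodI.of a) v) : ArrowGen (E i) u a v := by
  by_cases ha : a = 1
  · subst ha
    rw [map_one] at hp
    rw [hp.eq_of_one hf]
    exact .refl v
  · rw [← CoprodI.NeWord.prod_singleton a ha] at hp
    obtain ⟨w, hw, rfl⟩ := hp.readsList_neWord hf
    exact hw

end ArrowPath

theorem exists_neWord_prod_eq {x : CoprodI M} (hx : x ≠ 1) :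
    ∃ (i j : Bool) (w : CoprodI.NeWord M i j), w.prod = x := by
  classical
  obtain ⟨i, j, w, hw⟩ := CoprodI.NeWord.of_word (CoprodI.Word.equiv x) fun h => hx (by
    have h1 := CoprodI.Word.equiv.symm_apply_apply x
    rw [h] at h1
    exact h1.symm)
  refine ⟨i, j, w, ?_⟩
  rw [CoprodI.NeWord.prod, hw]
  exact CoprodI.Word.equiv.symm_apply_apply x

/-- A nontrivial normal subgroup contains elements whose normal form starts and ends in any
prescribed factor. -/
theorem exists_neWord_mem [∀ i, Nontrivial (M i)]
    (hM : ∀ x : M true, ∃ y, y ≠ 1 ∧ y * x ≠ 1) (N : Subgroup (CoprodI M)) [N.Normal]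
    (hN : N ≠ ⊥) (k : Bool) : ∃ w : CoprodI.NeWord M k k, w.prod ∈ N := by
  have conj : ∀ {i j : Bool} (_ : j ≠ i) (w : CoprodI.NeWord M i i), w.prod ∈ N →
      ∃ w : CoprodI.NeWord M j j, w.prod ∈ N := by
    intro i j hij w hw
    obtain ⟨a, ha⟩ := exists_ne (1 : M j)
    refine ⟨((CoprodI.NeWord.singleton a ha).append hij w).append hij.symm
      (CoprodI.NeWord.singleton a⁻¹ (inv_ne_one.2 ha)), ?_⟩
    simpa using ‹N.Normal›.conj_mem _ hw (CoprodI.of a)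
  have mixed : ∀ w : CoprodI.NeWord M true false, w.prod ∈ N →
      ∃ w : CoprodI.NeWord M true true, w.prod ∈ N := by
    intro w hw
    obtain ⟨y, hy, hyw⟩ := hM w.head
    refine ⟨(w.mulHead y hyw).append (by simp)
      (CoprodI.NeWord.singleton y⁻¹ (inv_ne_one.2 hy)), ?_⟩
    simpa using ‹N.Normal›.conj_mem _ hw (CoprodI.of y)
  obtain ⟨x, hxN, hx⟩ := N.bot_or_exists_ne_one.resolve_left hN
  obtain ⟨i, j, w, rfl⟩ := exists_neWord_prod_eq hx
  have htrue : ∃ w : CoprodI.NeWord M true true, w.prod ∈ N := by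
    match i, j, w, hxN with
    | true, true, w, hw => exact ⟨w, hw⟩
    | false, false, w, hw => exact conj (by simp) w hw
    | true, false, w, hw => exact mixed w hw
    | false, true, w, hw => exact mixed w.inv (by simpa using inv_mem hw)
  cases k with
  | true => exact htrue
  | false =>
    obtain ⟨w, hw⟩ := htrue
    exact conj (by simp) w hw

/-- A folded graph carrying loops for all elements of a nontrivial normal subgroup is complete. -/
theorem exists_path_of_folded [∀ i, Nontrivial (M i)]
    (hM : ∀ x : M true, ∃ y, y ≠ 1 ∧ y * x ≠ 1) {N : Subgroup (CoprodI M)} [N.Normal]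
    (hN : N ≠ ⊥) {E : ∀ i, List (ℕ × M i × ℕ)} (hf : ∀ i u v, ArrowGen (E i) u 1 v → u = v)
    (hp : ∀ x ∈ N, ArrowPath E 0 x 0) (x : CoprodI M) : ∃ v, ArrowPath E 0 x v := by
  by_cases hx : x = 1
  · exact ⟨0, hx ▸ .refl 0⟩
  · obtain ⟨i, j, w, rfl⟩ := exists_neWord_prod_eq hx
    obtain ⟨y, hy⟩ := exists_neWord_mem hM N hN !j
    have hj : j ≠ !j := by simp
    have h := hp ((w.append hj y).append hj.symm w.inv).prod
      (by simpa using ‹N.Normal›.conj_mem _ hy w.prod)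
    have h1 := h.readsList_neWord hf
    simp only [CoprodI.NeWord.toList, List.append_assoc] at h1
    obtain ⟨v, hv⟩ := ReadsList.exists_of_append h1
    exact ⟨v, hv.path⟩

/-- A nontrivial finitely generated normal subgroup of a free product has finite index, and the
number of its generators is bounded from below by the number of generators of its intersections
with the factors. -/
theorem finite_quotient_and_card_le [∀ i, Nontrivial (M i)]
    (hM : ∀ x : M true, ∃ y, y ≠ 1 ∧ y * x ≠ 1) {N : Subgroup (CoprodI M)} [N.Normal]
    (hN : N ≠ ⊥) (l : List (CoprodI M)) (hl : Subgroup.closure {x | x ∈ l} = N) :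
    Finite (CoprodI M ⧸ N) ∧ ∃ S : ∀ i, Finset (M i),
      (∀ i, Subgroup.closure (S i : Set (M i))
        = ((QuotientGroup.mk' N).comp (CoprodI.of (i := i))).ker) ∧
      ((QuotientGroup.mk' N).comp (CoprodI.of (i := true))).range.index * (S true).card
        + ((QuotientGroup.mk' N).comp (CoprodI.of (i := false))).range.index * (S false).card
        + Nat.card (CoprodI M ⧸ N) + 1
      ≤ l.length + ((QuotientGroup.mk' N).comp (CoprodI.of (i := true))).range.index
        + ((QuotientGroup.mk' N).comp (CoprodI.of (i := false))).range.index := by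
  obtain ⟨E₀, V₀, q, h₀, hl₀, hc₀⟩ := IsLabelledGraph.exists_of_list (QuotientGroup.mk' N) l
    fun y hy => by
      rw [← MonoidHom.mem_ker, QuotientGroup.ker_mk', ← hl]
      exact Subgroup.subset_closure hy
  obtain ⟨E, V, h, hf, hp, hc⟩ := h₀.exists_folded _ le_rfl
  have hNp : ∀ x ∈ N, ArrowPath E 0 x 0 := by
    intro x hx
    rw [← hl] at hx
    induction hx using Subgroup.closure_induction with
    | mem x hx => exact hp _ (hl₀ x hx)
    | one => exact .refl 0
    | mul x y _ _ hx hy => exact hx.trans hy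
    | inv x _ hx => exact hx.symm
  have hread := exists_path_of_folded hM hN hf hNp
  have huniq : ∀ {x y : CoprodI M} {u v : ℕ}, ArrowPath E 0 x u → ArrowPath E 0 y v →
      QuotientGroup.mk' N x = QuotientGroup.mk' N y → u = v := by
    intro x y u v hx hy hxy
    have hmem : x * y⁻¹ ∈ N := by
      rw [← QuotientGroup.ker_mk' N, MonoidHom.mem_ker, map_mul, map_inv, hxy, mul_inv_cancel]
    refine ArrowPath.eq_of_one hf ?_
    simpa [mul_assoc] using (hx.symm.trans (hNp _ hmem)).trans hy
  have hval : ∀ {x : CoprodI M} {v : ℕ}, ArrowPath E 0 x v → q v = QuotientGroup.mk' N x :=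
    fun hx => by rw [← h.path_compat hx, h.base_eq, one_mul]
  have hex : ∀ g : CoprodI M ⧸ N, ∃ v x, QuotientGroup.mk' N x = g ∧ ArrowPath E 0 x v := by
    intro g
    obtain ⟨x, hx⟩ := QuotientGroup.mk'_surjective N g
    obtain ⟨v, hv⟩ := hread x
    exact ⟨v, x, hx, hv⟩
  choose s t ht hs using hex
  have hqs : ∀ g, q (s g) = g := fun g => by rw [hval (hs g), ht]
  have hinj : Function.Injective s := Function.LeftInverse.injective hqs
  have hsV : ∀ g, s g ∈ V := fun g => h.path_mem (hs g) h.base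
  have hVs : ∀ v ∈ V, v ∈ Set.range s := fun v hv => by
    obtain ⟨x, hx⟩ := h.conn v hv
    exact ⟨q v, huniq (hs _) hx (by rw [ht, hval hx])⟩
  have hfin : Finite (CoprodI M ⧸ N) :=
    Finite.of_injective (fun g => (⟨s g, hsV g⟩ : V)) fun g g' hg => hinj (by simpa using hg)
  have hcard : V.card = Nat.card (CoprodI M ⧸ N) := by
    rw [← Nat.card_eq_card_finite_toFinset (Set.finite_range s) |>.symm.trans
      (Nat.card_range_of_injective hinj)]
    congr 1
    ext v
    simp only [Set.Finite.mem_toFinset]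
    exact ⟨hVs v, by rintro ⟨g, rfl⟩; exact hsV g⟩
  have hgen : ∀ i g (a : M i) g', ArrowGen (E i) (s g) a (s g') ↔
      g * ((QuotientGroup.mk' N).comp (CoprodI.of (i := i))) a = g' := by
    intro i g a g'
    constructor
    · intro hg
      simpa [hqs] using h.gen_compat hg
    · intro hg
      obtain ⟨w, hw⟩ := hread (t g * CoprodI.of a)
      have hw' : w = s g' := huniq hw (hs g') (by rw [map_mul, ht, ht]; exact hg)
      subst hw'
      exact ArrowPath.gen_of_of hf (by simpa using (hs g).symm.trans hw)
  choose S hS hSc using fun i => ArrowGen.exists_closure_eq_ker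
    ((QuotientGroup.mk' N).comp (CoprodI.of (i := i))) hinj
    (fun e he => ⟨hVs _ (h.inside i e he).1, hVs _ (h.inside i e he).2⟩) (hgen i)
  refine ⟨hfin, S, hS, ?_⟩
  have h1 := hSc true
  have h2 := hSc false
  omega

end Folding

/-! ### Finite perfect groups and numbers of generators -/

theorem exists_closure_eq_top_two_pow_card_le (B : Type*) [Group B] [Finite B] :
    ∃ S : Finset B, Subgroup.closure (S : Set B) = ⊤ ∧ 2 ^ S.card ≤ Nat.card B := by
  classical
  have := Fintype.ofFinite B
  let P : Finset (Finset B) :=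
    Finset.univ.filter fun S => 2 ^ S.card ≤ Nat.card (Subgroup.closure (S : Set B))
  obtain ⟨S, hS, hmax⟩ := P.exists_max_image Finset.card ⟨∅, by simp [P]⟩
  have hS' : 2 ^ S.card ≤ Nat.card (Subgroup.closure (S : Set B)) := (Finset.mem_filter.1 hS).2
  have htop : Subgroup.closure (S : Set B) = ⊤ := by
    by_contra hne
    obtain ⟨x, -, hx⟩ := SetLike.exists_of_lt (lt_top_iff_ne_top.2 hne)
    have hxS : x ∉ S := fun h => hx (Subgroup.subset_closure h)
    have hle : Subgroup.closure (S : Set B) ≤ Subgroup.closure ((insert x S : Finset B) : Set B) :=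
      Subgroup.closure_mono (by simp)
    obtain ⟨c, hc⟩ := Subgroup.card_dvd_of_le hle
    have hc0 : c ≠ 0 := by
      rintro rfl
      exact Nat.card_pos.ne' hc
    have hc1 : c ≠ 1 := by
      rintro rfl
      refine hx ?_
      rw [Subgroup.eq_of_le_of_card_ge hle (by rw [hc, mul_one])]
      exact Subgroup.subset_closure (by simp)
    have hmem : insert x S ∈ P := by
      refine Finset.mem_filter.2 ⟨Finset.mem_univ _, ?_⟩
      rw [Finset.card_insert_of_notMem hxS, hc, pow_succ]
      exact Nat.mul_le_mul hS' (by omega)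
    have := hmax _ hmem
    rw [Finset.card_insert_of_notMem hxS] at this
    omega
  exact ⟨S, htop, by rwa [htop, Subgroup.card_top] at hS'⟩

/-- The number of generators is at most that of the kernel plus the binary logarithm of the order
of the image. -/
theorem exists_rank_le_card_add {A Q : Type*} [Group A] [Group.FG A] [Group Q] [Finite Q]
    (f : A →* Q) (S : Finset A) (hS : Subgroup.closure (S : Set A) = f.ker) :
    ∃ l : ℕ, Group.rank A ≤ S.card + l ∧ 2 ^ l ≤ Nat.card f.range := by
  classical
  obtain ⟨T, hT, hTc⟩ := exists_closure_eq_top_two_pow_card_le f.range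
  choose g hg using f.rangeRestrict_surjective
  refine ⟨T.card, ?_, hTc⟩
  refine (Group.rank_le (S := S ∪ T.image g) ?_).trans
    ((Finset.card_union_le _ _).trans (Nat.add_le_add_left Finset.card_image_le _))
  set C := Subgroup.closure ((S ∪ T.image g : Finset A) : Set A) with hC
  have hker : f.rangeRestrict.ker ≤ C := by
    rw [MonoidHom.ker_rangeRestrict, ← hS]
    exact Subgroup.closure_mono (by simp)
  have hmap : C.map f.rangeRestrict = ⊤ := by
    rw [← top_le_iff, ← hT, Subgroup.closure_le]
    intro b hb
    exact ⟨g b, Subgroup.subset_closure (by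
      simp only [Finset.coe_union, Finset.coe_image]
      exact .inr ⟨b, hb, rfl⟩), hg b⟩
  rw [← Subgroup.comap_map_eq_self hker, hmap, Subgroup.comap_top]

theorem subsingleton_of_perfect_of_card_le {Q : Type*} [Group Q] [Finite Q]
    (hQ : commutator Q = ⊤) (hc : Nat.card Q ≤ 8) : Subsingleton Q := by
  have hsol : Group.IsSolvable Q := by
    have hpos : 0 < Nat.card Q := Nat.card_pos
    have htwo : ∀ k, Nat.card Q = 2 ^ k → Group.IsSolvable Q := fun k hk => by
      have : Fact (Nat.Prime 2) := ⟨Nat.prime_two⟩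
      have := (IsPGroup.of_card hk).isNilpotent
      infer_instance
    have hsq : Squarefree (Nat.card Q) → Group.IsSolvable Q := fun h => by
      have := IsZGroup.of_squarefree h
      infer_instance
    generalize Nat.card Q = n at *
    interval_cases n
    · exact htwo 0 rfl
    · exact htwo 1 rfl
    · exact hsq (by decide +kernel)
    · exact htwo 2 rfl
    · exact hsq (by decide +kernel)
    · exact hsq (by decide +kernel)
    · exact hsq (by decide +kernel)
    · exact htwo 3 rfl
  by_contra hns
  rw [not_subsingleton_iff_nontrivial] at hns
  exact (Group.IsSolvable.commutator_lt_top_of_nontrivial Q).ne hQ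

theorem two_mul_add_le {n k m l h : ℕ} (hkm : k * m = n) (hn : 0 < n) (hl : 2 ^ l ≤ m)
    (hm : h = 0 → 2 ≤ m) : 2 * (k + l + h) ≤ n + 2 + 2 * (k * h) := by
  have hk : 0 < k := Nat.pos_of_ne_zero fun h0 => by simp [h0] at hkm; omega
  have hm' : m ≤ n := hkm ▸ Nat.le_mul_of_pos_left m hk
  have hpow : 2 * l ≤ 2 ^ l := by
    rcases l with _ | l
    · simp
    · have := Nat.lt_two_pow_self (n := l)
      rw [pow_succ]
      omega
  rcases Nat.eq_zero_or_pos h with h0 | hpos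
  · have h2 := hm h0
    subst h0
    rcases Nat.lt_or_ge l 2 with hl2 | hl2
    · nlinarith
    · nlinarith
  · nlinarith

theorem four_mul_add_le {n k m l h : ℕ} (hkm : k * m = n) (hn : 0 < n) (hl : 2 ^ l ≤ m)
    (hm : h = 0 → 4 ≤ m) : 4 * (k + l + h) ≤ n + 8 + 4 * (k * h) := by
  have hk : 0 < k := Nat.pos_of_ne_zero fun h0 => by simp [h0] at hkm; omega
  have hm' : m ≤ n := hkm ▸ Nat.le_mul_of_pos_left m hk
  have hpow : 4 * l ≤ 2 ^ l + 4 := by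
    induction l using Nat.strong_induction_on with
    | _ l ih =>
      rcases l with _ | _ | _ | l
      · simp
      · simp
      · simp
      · have := Nat.lt_two_pow_self (n := l)
        rw [pow_succ, pow_succ, pow_succ]
        omega
  rcases Nat.eq_zero_or_pos h with h0 | hpos
  · have h4 := hm h0
    subst h0
    nlinarith [Nat.mul_le_mul hk h4]
  · nlinarith

/-- A nontrivial normal endomorphic image with perfect quotient is everything. -/
theorem range_eq_top_of_perfect {M : Bool → Type*} [∀ i, Group (M i)] [∀ i, Nontrivial (M i)]
    [∀ i, Group.FG (M i)] (hM : ¬ IsCyclic (M true))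
    (φ : Monoid.CoprodI M →* Monoid.CoprodI M) [φ.range.Normal] (hφ : φ.range ≠ ⊥)
    (hQ : commutator (Monoid.CoprodI M ⧸ φ.range) = ⊤) : φ.range = ⊤ := by
  classical
  have hM' : ∀ x : M true, ∃ y, y ≠ 1 ∧ y * x ≠ 1 := by
    by_contra! ⟨x, hx⟩
    refine hM ⟨x⁻¹, fun y => ?_⟩
    by_cases hy : y = 1
    · exact ⟨0, by simp [hy]⟩
    · exact eq_inv_of_mul_eq_one_left (hx y hy) ▸ Subgroup.mem_zpowers _
  choose T hTc hT using fun i => Group.rank_spec (M i)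
  let l : List (Monoid.CoprodI M) :=
    (T true).toList.map (fun x => φ (Monoid.CoprodI.of x)) ++
      (T false).toList.map (fun x => φ (Monoid.CoprodI.of x))
  have hmem : ∀ i, ∀ x ∈ T i, φ (Monoid.CoprodI.of x) ∈ l := by
    rintro (_ | _) x hx
    · exact List.mem_append_right _ (List.mem_map.2 ⟨x, by simpa using hx, rfl⟩)
    · exact List.mem_append_left _ (List.mem_map.2 ⟨x, by simpa using hx, rfl⟩)
  have hl : Subgroup.closure {x | x ∈ l} = φ.range := by
    apply le_antisymm
    · rw [Subgroup.closure_le]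
      intro x hx
      simp only [l, Set.mem_ofPred_eq, List.mem_append, List.mem_map] at hx
      rcases hx with ⟨y, -, rfl⟩ | ⟨y, -, rfl⟩ <;> exact ⟨_, rfl⟩
    · have hlift : φ = Monoid.CoprodI.lift fun i => φ.comp (Monoid.CoprodI.of (i := i)) := by
        ext i x
        simp
      rw [hlift]
      refine Monoid.CoprodI.lift_range_le _ _ fun i => ?_
      rw [MonoidHom.range_eq_map, ← hT i, MonoidHom.map_closure, Subgroup.closure_le]
      rintro _ ⟨x, hx, rfl⟩
      exact Subgroup.subset_closure (hmem i x hx)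
  have hlen : l.length = Group.rank (M true) + Group.rank (M false) := by
    simp [l, hTc]
  obtain ⟨hfin, S, hS, hcount⟩ := finite_quotient_and_card_le hM' hφ l hl
  let f : ∀ i, M i →* Monoid.CoprodI M ⧸ φ.range := fun i =>
    (QuotientGroup.mk' φ.range).comp (Monoid.CoprodI.of (i := i))
  choose r hr hr2 using fun i => exists_rank_le_card_add (f i) (S i) (hS i)
  have hinj : ∀ i, (S i).card = 0 → Finite (M i) ∧ Nat.card (M i) = Nat.card (f i).range := by
    intro i h0
    have hker : (f i).ker = ⊥ := by
      rw [← hS i, Finset.card_eq_zero.1 h0]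
      simp
    have hi := (f i).ker_eq_bot_iff.1 hker
    exact ⟨Finite.of_injective _ hi, Nat.card_congr (MonoidHom.ofInjective hi).toEquiv⟩
  have htwo : ∀ i, (S i).card = 0 → 2 ≤ Nat.card (f i).range := by
    intro i h0
    obtain ⟨hfi, he⟩ := hinj i h0
    rw [← he]
    exact Finite.one_lt_card
  have hfour : (S true).card = 0 → 4 ≤ Nat.card (f true).range := by
    intro h0
    have h2 := htwo true h0
    obtain ⟨hfi, he⟩ := hinj true h0
    by_contra! hlt
    rw [← he] at h2 hlt
    obtain h | h : Nat.card (M true) = 2 ∨ Nat.card (M true) = 3 := by omega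
    · have : Fact (Nat.Prime 2) := ⟨Nat.prime_two⟩
      exact hM (isCyclic_of_prime_card h)
    · have : Fact (Nat.Prime 3) := ⟨Nat.prime_three⟩
      exact hM (isCyclic_of_prime_card h)
  have h4 := four_mul_add_le (f true).range.index_mul_card Nat.card_pos (hr2 true) hfour
  have h2 := two_mul_add_le (f false).range.index_mul_card Nat.card_pos (hr2 false) (htwo false)
  have := hr true
  have := hr false
  have := subsingleton_of_perfect_of_card_le hQ (by simp only [f] at *; omega)
  exact QuotientGroup.subsingleton_iff.1 this

/-! ### Binary free products -/

theorem commutator_quotient_eq_top_iff {G : Type*} [Group G] (N : Subgroup G) [N.Normal] :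
    commutator (G ⧸ N) = ⊤ ↔ commutator G ⊔ N = ⊤ := by
  have hsurj := QuotientGroup.mk'_surjective N
  have hmap : (commutator G).map (QuotientGroup.mk' N) = commutator (G ⧸ N) := by
    rw [commutator_def, Subgroup.map_commutator, Subgroup.map_top_of_surjective _ hsurj,
      commutator_def]
  rw [← hmap, ← (Subgroup.comap_injective hsurj).eq_iff, Subgroup.comap_map_eq,
    QuotientGroup.ker_mk', Subgroup.comap_top]

/-- The isomorphism between the binary free product and the free product indexed by `Bool`. -/
def coprodMulEquivCoprodI (M : Bool → Type*) [∀ i, Group (M i)] :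
    Monoid.Coprod (M true) (M false) ≃* Monoid.CoprodI M :=
  MonoidHom.toMulEquiv
    (Monoid.Coprod.lift Monoid.CoprodI.of Monoid.CoprodI.of)
    (Monoid.CoprodI.lift fun i => match i with
      | true => Monoid.Coprod.inl
      | false => Monoid.Coprod.inr)
    (by ext x <;> simp)
    (by ext i x; cases i <;> simp)

theorem perfectlyHopfian_coprod {M : Bool → Type*} [∀ i, Group (M i)] [∀ i, Nontrivial (M i)]
    [∀ i, Group.FG (M i)] (hM : ¬ IsCyclic (M true))
    (hH : IsHopfianGroup (Monoid.Coprod (M true) (M false)))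
    (hnp : commutator (Monoid.Coprod (M true) (M false)) ≠ ⊤) :
    PerfectlyHopfian (Monoid.Coprod (M true) (M false)) := by
  intro φ hn hQ
  refine hH φ ?_
  rw [commutator_quotient_eq_top_iff] at hQ
  have hφ : φ.range ≠ ⊥ := fun h => hnp (by rwa [h, sup_bot_eq] at hQ)
  let e : Monoid.Coprod (M true) (M false) →* Monoid.CoprodI M := coprodMulEquivCoprodI M
  have hinj : Function.Injective e := (coprodMulEquivCoprodI M).injective
  have hsurj : Function.Surjective e := (coprodMulEquivCoprodI M).surjective
  let ψ := (e.comp φ).comp (coprodMulEquivCoprodI M).symm.toMonoidHom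
  have hsymm : (coprodMulEquivCoprodI M).symm.toMonoidHom.range = ⊤ :=
    MonoidHom.range_eq_top.2 (coprodMulEquivCoprodI M).symm.surjective
  have hψ : ψ.range = φ.range.map e := by
    rw [MonoidHom.range_comp, hsymm, ← MonoidHom.range_eq_map, MonoidHom.range_comp]
  have : ψ.range.Normal := hψ ▸ hn.map _ hsurj
  have htop := range_eq_top_of_perfect hM ψ
    (by rwa [hψ, Ne, Subgroup.map_eq_bot_iff_of_injective _ hinj])
    (by
      rw [commutator_quotient_eq_top_iff, hψ, ← Subgroup.map_top_of_surjective e hsurj, ← hQ,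
        Subgroup.map_sup, commutator_def, commutator_def, Subgroup.map_commutator,
        Subgroup.map_top_of_surjective e hsurj])
  rw [hψ, ← Subgroup.map_top_of_surjective e hsurj] at htop
  exact MonoidHom.range_eq_top.1 (Subgroup.map_injective hinj htop)

theorem freeProduct_hopfian_isPerfectlyHopfian
    (G₁ G₂ : Type) [Group G₁] [Group G₂] [Nontrivial G₁] [Nontrivial G₂]
    [Group.FG G₁] [Group.FG G₂] (hnc : ¬ IsCyclic G₁)
    (hH : IsHopfianGroup (Monoid.Coprod G₁ G₂))
    (hnp : commutator (Monoid.Coprod G₁ G₂) ≠ ⊤) :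
    PerfectlyHopfian (Monoid.Coprod G₁ G₂) := by
  let M : Bool → Type := fun i => cond i G₁ G₂
  have : ∀ i, Nontrivial (M i) := by rintro (_ | _) <;> assumption
  let _ : ∀ i, Group (M i)
    | true => ‹Group G₁›
    | false => ‹Group G₂›
  have : ∀ i, Group.FG (M i) := by rintro (_ | _) <;> assumption
  exact perfectlyHopfian_coprod (M := M) hnc hH hnp
end
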